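/- arXiv:2402.15169 — 4 statements merged into one kernel-verified Lean document; each statement's English description precedes it below -/
import Mathlib

section
/- There is a universal constant C > 0 such that for every unit-weight collaboration instance on a finite vertex set V of size n ≥ 2, there exists a persuasive binary identity-independent signaling scheme D whose cost satisfies Cost(D) ≤ C · √n · OPT. -/
open Finset

variable {V : Type*}

/-- A collaboration instance: symmetric matrix with entries in [0,1] and unit diagonal. -/
def IsCollab [Fintype V] (W : V → V → ℝ) : Prop :=
  (∀ u v, W u v = W v u) ∧ (∀ u v, 0 ≤ W u v ∧ W u v ≤ 1) ∧ (∀ v, W v v = 1)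

/-- Unit-weight instance: off-diagonal entries are 0 or 1. -/
def UnitWeight (W : V → V → ℝ) : Prop :=
  ∀ u v : V, u ≠ v → W u v = 0 ∨ W u v = 1

/-- Feasible solution: nonnegative with `W θ ≥ 1` coordinatewise. -/
def Feasible [Fintype V] (W : V → V → ℝ) (θ : V → ℝ) : Prop :=
  (∀ v, 0 ≤ θ v) ∧ ∀ v, 1 ≤ ∑ u, W v u * θ u

/-- Optimal total workload among feasible solutions. -/
noncomputable def OPT [Fintype V] (W : V → V → ℝ) : ℝ :=
  sInf {c : ℝ | ∃ θ : V → ℝ, Feasible W θ ∧ c = ∑ v, θ v}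

/-- Optimal total workload among feasible solutions satisfying IR (`θ ≤ 1`). -/
noncomputable def OPTIR [Fintype V] (W : V → V → ℝ) : ℝ :=
  sInf {c : ℝ | ∃ θ : V → ℝ, Feasible W θ ∧ (∀ v, θ v ≤ 1) ∧ c = ∑ v, θ v}

/-- An identity-independent signaling scheme: a finitely supported probability
distribution over signal functions `s : V → ℝ` whose values lie in a finite
signal space `sig ⊆ [0,1]`. -/
structure Scheme (V : Type*) [Fintype V] where
  sig : Finset ℝ
  sig_mem : ∀ θ ∈ sig, 0 ≤ θ ∧ θ ≤ 1
  supp : Finset (V → ℝ)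
  val_mem : ∀ s ∈ supp, ∀ v : V, s v ∈ sig
  p : (V → ℝ) → ℝ
  p_nonneg : ∀ s ∈ supp, 0 ≤ p s
  p_sum : ∑ s ∈ supp, p s = 1

/-- Expectation of `f` under the scheme's distribution. -/
noncomputable def Scheme.exp [Fintype V] (D : Scheme V) (f : (V → ℝ) → ℝ) : ℝ :=
  ∑ s ∈ D.supp, D.p s * f s

/-- Expected number of vertices receiving signal `θ`. -/
noncomputable def Scheme.Num [Fintype V] (D : Scheme V) (θ : ℝ) : ℝ :=
  D.exp (fun s => ∑ v, if s v = θ then (1 : ℝ) else 0)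

/-- Expected total contribution entering vertices receiving signal `θ`
(the neighborhood sum `∑_{u ∈ N(v)} W v u * s u` equals `∑_{u ≠ v} W v u * s u`). -/
noncomputable def Scheme.Contrib [Fintype V] [DecidableEq V] (D : Scheme V)
    (W : V → V → ℝ) (θ : ℝ) : ℝ :=
  D.exp (fun s => ∑ v, if s v = θ then ∑ u ∈ Finset.univ.erase v, W v u * s u else 0)

/-- The slack of signal `θ`. -/
noncomputable def Scheme.slack [Fintype V] [DecidableEq V] (D : Scheme V)
    (W : V → V → ℝ) (θ : ℝ) : ℝ :=
  D.Contrib W θ - (1 - θ) * D.Num θ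

/-- Persuasiveness: zero slack at positive signals, nonnegative slack at signal 0. -/
def Scheme.Persuasive [Fintype V] [DecidableEq V] (D : Scheme V) (W : V → V → ℝ) : Prop :=
  (∀ θ ∈ D.sig, 0 < θ → D.slack W θ = 0) ∧ ((0 : ℝ) ∈ D.sig → 0 ≤ D.slack W 0)

/-- Cost of a scheme: expected total signal value. -/
noncomputable def Scheme.cost [Fintype V] (D : Scheme V) : ℝ :=
  D.exp (fun s => ∑ v, s v)

/-- The signal function sending `θ` to the members of `S` and `0` to everybody else. -/
noncomputable def indicatorSignal [DecidableEq V] (S : Finset V) (θ : ℝ) : V → ℝ :=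
  fun v => if v ∈ S then θ else 0

lemma indicatorSignal_injective [DecidableEq V] {θ : ℝ} (hθ : 0 < θ) :
    Function.Injective fun S : Finset V => indicatorSignal S θ := by
  intro A B h
  ext v
  have hv := congrFun h v
  by_cases hA : v ∈ A <;> by_cases hB : v ∈ B <;>
    simp_all [indicatorSignal, hθ.ne, hθ.ne']

/-- Total weight inside `S`, the diagonal included. -/
def innerWeight (W : V → V → ℝ) (S : Finset V) : ℝ := ∑ v ∈ S, ∑ u ∈ S, W v u

/-- Total weight between `V` and `S`, the diagonal included. -/
def coverWeight [Fintype V] (W : V → V → ℝ) (S : Finset V) : ℝ := ∑ v, ∑ u ∈ S, W v u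

lemma sum_indicatorSignal [Fintype V] [DecidableEq V] (S : Finset V) (θ : ℝ) :
    ∑ v, indicatorSignal S θ v = θ * #S := by
  simp [indicatorSignal, Finset.sum_ite_mem, mul_comm]

lemma count_indicatorSignal_pos [Fintype V] [DecidableEq V] {θ : ℝ} (hθ : 0 < θ) (S : Finset V) :
    (∑ v, if indicatorSignal S θ v = θ then (1 : ℝ) else 0) = #S := by
  have h : ∀ v, indicatorSignal S θ v = θ ↔ v ∈ S := by
    intro v
    by_cases hv : v ∈ S <;> simp [indicatorSignal, hv, hθ.ne]
  simp [h]

lemma count_indicatorSignal_zero [Fintype V] [DecidableEq V] {θ : ℝ} (hθ : 0 < θ) (S : Finset V) :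
    (∑ v, if indicatorSignal S θ v = 0 then (1 : ℝ) else 0) = Fintype.card V - #S := by
  have h : ∀ v, (if indicatorSignal S θ v = 0 then (1 : ℝ) else 0)
      = 1 - if v ∈ S then 1 else 0 := by
    intro v
    by_cases hv : v ∈ S <;> simp [indicatorSignal, hv, hθ.ne']
  simp [h, Finset.sum_sub_distrib]

lemma contrib_indicatorSignal [Fintype V] [DecidableEq V]
    (W : V → V → ℝ) (S : Finset V) (θ : ℝ) (v : V) :
    ∑ u ∈ Finset.univ.erase v, W v u * indicatorSignal S θ u
      = θ * (∑ u ∈ S, W v u) - W v v * indicatorSignal S θ v := by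
  rw [Finset.sum_erase_eq_sub (Finset.mem_univ v)]
  congr 1
  simp [indicatorSignal, Finset.sum_ite_mem, Finset.mul_sum, mul_comm]

lemma contrib_indicatorSignal_pos [Fintype V] [DecidableEq V]
    {W : V → V → ℝ} (hW : ∀ v, W v v = 1) {θ : ℝ}
    (hθ : 0 < θ) (S : Finset V) :
    (∑ v, if indicatorSignal S θ v = θ then
        ∑ u ∈ Finset.univ.erase v, W v u * indicatorSignal S θ u else 0)
      = θ * (innerWeight W S - #S) := by
  have h : ∀ v, (if indicatorSignal S θ v = θ then
        ∑ u ∈ Finset.univ.erase v, W v u * indicatorSignal S θ u else 0)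
      = if v ∈ S then θ * (∑ u ∈ S, W v u) - θ else 0 := by
    intro v
    rw [contrib_indicatorSignal, hW]
    by_cases hv : v ∈ S <;> simp [indicatorSignal, hv, hθ.ne]
  simp_rw [h]
  rw [Finset.sum_ite_mem, Finset.univ_inter, Finset.sum_sub_distrib, ← Finset.mul_sum]
  simp [innerWeight]
  ring

lemma contrib_indicatorSignal_zero [Fintype V] [DecidableEq V] {W : V → V → ℝ} {θ : ℝ}
    (hθ : 0 < θ) (S : Finset V) :
    (∑ v, if indicatorSignal S θ v = 0 then
        ∑ u ∈ Finset.univ.erase v, W v u * indicatorSignal S θ u else 0)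
      = θ * (coverWeight W S - innerWeight W S) := by
  have h : ∀ v, (if indicatorSignal S θ v = 0 then
        ∑ u ∈ Finset.univ.erase v, W v u * indicatorSignal S θ u else 0)
      = θ * (∑ u ∈ S, W v u) - if v ∈ S then θ * (∑ u ∈ S, W v u) else 0 := by
    intro v
    rw [contrib_indicatorSignal]
    by_cases hv : v ∈ S <;> simp [indicatorSignal, hv, hθ.ne']
  simp_rw [h]
  rw [Finset.sum_sub_distrib, Finset.sum_ite_mem, Finset.univ_inter, ← Finset.mul_sum,
    ← Finset.mul_sum]
  simp [innerWeight, coverWeight]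
  ring

/-- Mixing two indicator signals with the same level `θ` gives a persuasive binary scheme as soon
as the expected inner weight balances the expected size and the expected cover weight is large. -/
lemma exists_scheme_of_two_sets [Fintype V] [DecidableEq V]
    {W : V → V → ℝ} (hW : ∀ v, W v v = 1) {A B : Finset V}
    (hAB : A ≠ B) {θ a : ℝ} (hθ : 0 < θ) (hθ1 : θ ≤ 1) (ha : 0 ≤ a) (ha1 : a ≤ 1)
    (hbal : θ * ((1 - a) * innerWeight W A + a * innerWeight W B) = (1 - a) * #A + a * #B)
    (hcov : Fintype.card V ≤ θ * ((1 - a) * coverWeight W A + a * coverWeight W B)) :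
    ∃ D : Scheme V, #D.sig ≤ 2 ∧ D.Persuasive W ∧
      D.cost = θ * ((1 - a) * #A + a * #B) := by
  classical
  have hne : indicatorSignal A θ ≠ indicatorSignal B θ :=
    fun h => hAB (indicatorSignal_injective hθ h)
  let D : Scheme V :=
    { sig := {0, θ}
      sig_mem := by
        intro x hx
        rcases Finset.mem_insert.1 hx with rfl | hx
        · simp
        · rw [Finset.mem_singleton.1 hx]
          exact ⟨hθ.le, hθ1⟩
      supp := {indicatorSignal A θ, indicatorSignal B θ}
      val_mem := by
        intro s hs v
        simp only [Finset.mem_insert, Finset.mem_singleton] at hs ⊢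
        rcases hs with rfl | rfl <;> unfold indicatorSignal <;> split_ifs <;> simp
      p := fun s => if s = indicatorSignal B θ then a else 1 - a
      p_nonneg := by
        intro s _
        split_ifs <;> linarith
      p_sum := by
        rw [Finset.sum_pair hne]
        simp [hne] }
  have hexp : ∀ f : (V → ℝ) → ℝ,
      D.exp f = (1 - a) * f (indicatorSignal A θ) + a * f (indicatorSignal B θ) := by
    intro f
    simp only [Scheme.exp, D]
    rw [Finset.sum_pair hne]
    simp [hne]
  refine ⟨D, Finset.card_le_two, ⟨?_, ?_⟩, ?_⟩
  · intro x hx hx0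
    have hxθ : x = θ := by
      rcases Finset.mem_insert.1 hx with rfl | hx
      · exact absurd hx0 (lt_irrefl _)
      · exact Finset.mem_singleton.1 hx
    subst hxθ
    rw [Scheme.slack, Scheme.Contrib, Scheme.Num, hexp, hexp]
    simp only [count_indicatorSignal_pos hθ, contrib_indicatorSignal_pos hW hθ]
    linear_combination hbal
  · intro _
    rw [Scheme.slack, Scheme.Contrib, Scheme.Num, hexp, hexp]
    simp only [count_indicatorSignal_zero hθ, contrib_indicatorSignal_zero hθ]
    linarith
  · rw [Scheme.cost, hexp]
    simp only [sum_indicatorSignal]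
    ring

/-- A fractional selection of total mass at most `m` is dominated by some `m`-element set. -/
lemma exists_card_eq_sum_mul_le [Fintype V] [DecidableEq V]
    {g t : V → ℝ} (hg : ∀ v, 0 ≤ g v) (ht0 : ∀ v, 0 ≤ t v)
    (ht1 : ∀ v, t v ≤ 1) {m : ℕ} (hm : 0 < m) (hmV : m ≤ Fintype.card V)
    (hsum : ∑ v, t v ≤ m) :
    ∃ S : Finset V, #S = m ∧ ∑ v, t v * g v ≤ ∑ v ∈ S, g v := by
  obtain ⟨S, hS, hmax⟩ := Finset.exists_max_image (Finset.univ.powersetCard m)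
    (fun S => ∑ v ∈ S, g v) (Finset.powersetCard_nonempty.2 (by simpa using hmV))
  have hcard : #S = m := (Finset.mem_powersetCard.1 hS).2
  refine ⟨S, hcard, ?_⟩
  obtain ⟨w, hwS, hw⟩ := Finset.exists_min_image S g (Finset.card_pos.1 (by omega))
  have hout : ∀ u, u ∉ S → g u ≤ g w := by
    intro u hu
    have hu' : u ∉ S.erase w := fun h => hu (Finset.mem_of_mem_erase h)
    have hmem : insert u (S.erase w) ∈ Finset.univ.powersetCard m := by
      rw [Finset.mem_powersetCard]
      refine ⟨Finset.subset_univ _, ?_⟩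
      rw [Finset.card_insert_of_notMem hu', Finset.card_erase_of_mem hwS]
      omega
    have h := hmax _ hmem
    simp only [Finset.sum_insert hu', Finset.sum_erase_eq_sub hwS] at h
    linarith
  have hpt : ∀ v, t v * g v ≤ (if v ∈ S then g v else 0) + g w * t v
      - if v ∈ S then g w else 0 := by
    intro v
    by_cases hv : v ∈ S
    · simp only [hv, if_true]
      nlinarith [hw v hv, ht1 v]
    · simp only [hv, if_false]
      nlinarith [hout v hv, ht0 v]
  calc ∑ v, t v * g v ≤ _ := Finset.sum_le_sum fun v _ => hpt v
    _ = ∑ v ∈ S, g v + g w * ∑ v, t v - m * g w := by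
      simp [Finset.sum_sub_distrib, Finset.sum_add_distrib, Finset.mul_sum, hcard]
    _ ≤ ∑ v ∈ S, g v := by nlinarith [hg w]

/-- Every unit-weight instance has a maximal independent set. -/
lemma exists_maximal_independent [Fintype V] [DecidableEq V]
    {W : V → V → ℝ} (hW : IsCollab W) (hu : UnitWeight W) :
    ∃ I : Finset V, (∀ u ∈ I, ∀ v ∈ I, u ≠ v → W u v = 0) ∧ ∀ v, 1 ≤ ∑ u ∈ I, W v u := by
  classical
  obtain ⟨I, hI, hmax⟩ := Finset.exists_max_image
    (Finset.univ.filter fun I : Finset V => ∀ u ∈ I, ∀ v ∈ I, u ≠ v → W u v = 0)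
    Finset.card ⟨∅, by simp⟩
  have hind := (Finset.mem_filter.1 hI).2
  refine ⟨I, hind, fun v => ?_⟩
  obtain ⟨u, huI, huv⟩ : ∃ u ∈ I, W v u = 1 := by
    by_cases hv : v ∈ I
    · exact ⟨v, hv, hW.2.2 v⟩
    by_contra! hcon
    have hzero : ∀ u ∈ I, W v u = 0 := fun u h =>
      (hu v u (by rintro rfl; exact hv h)).resolve_right (hcon u h)
    have hins : insert v I ∈
        Finset.univ.filter fun I : Finset V => ∀ u ∈ I, ∀ v ∈ I, u ≠ v → W u v = 0 := by
      refine Finset.mem_filter.2 ⟨Finset.mem_univ _, ?_⟩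
      intro x hx y hy hxy
      rcases Finset.mem_insert.1 hx with rfl | hx' <;>
        rcases Finset.mem_insert.1 hy with rfl | hy'
      · exact absurd rfl hxy
      · exact hzero y hy'
      · rw [hW.1]
        exact hzero x hx'
      · exact hind x hx' y hy' hxy
    have hle := hmax _ hins
    rw [Finset.card_insert_of_notMem hv] at hle
    omega
  calc (1 : ℝ) = W v u := huv.symm
    _ ≤ _ := Finset.single_le_sum (f := fun u => W v u) (fun x _ => (hW.2.1 v x).1) huI

lemma innerWeight_of_independent {W : V → V → ℝ} (hW : ∀ v, W v v = 1) {I : Finset V}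
    (hI : ∀ u ∈ I, ∀ v ∈ I, u ≠ v → W u v = 0) : innerWeight W I = #I := by
  have h : ∀ v ∈ I, ∑ u ∈ I, W v u = 1 := fun v hv => by
    rw [Finset.sum_eq_single_of_mem v hv fun u hu huv => hI v hv u hu huv.symm, hW]
  rw [innerWeight, Finset.sum_congr rfl h]
  simp

/-- A set covering every vertex at least once covers with multiplicity, because the fractional
solution is itself covered from the other side. -/
lemma le_coverWeight_of_dominating [Fintype V] {W : V → V → ℝ} (hW : IsCollab W) {t : V → ℝ}
    (ht : Feasible W t) (ht1 : ∀ v, t v ≤ 1) {I : Finset V} (hI : ∀ v, 1 ≤ ∑ u ∈ I, W v u) :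
    Fintype.card V - ∑ v, t v + #I ≤ coverWeight W I := by
  have hswap : (#I : ℝ) ≤ ∑ v, t v * ∑ u ∈ I, W v u := by
    calc (#I : ℝ) = ∑ u ∈ I, (1 : ℝ) := by simp
      _ ≤ ∑ u ∈ I, ∑ v, W u v * t v := Finset.sum_le_sum fun u _ => ht.2 u
      _ = ∑ v, t v * ∑ u ∈ I, W v u := by
        rw [Finset.sum_comm]
        refine Finset.sum_congr rfl fun v _ => ?_
        rw [Finset.mul_sum]
        exact Finset.sum_congr rfl fun u _ => by rw [hW.1 u v, mul_comm]
  have hrest : ∑ v, (1 - t v) ≤ ∑ v, (1 - t v) * ∑ u ∈ I, W v u :=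
    Finset.sum_le_sum fun v _ => le_mul_of_one_le_right (by linarith [ht1 v]) (hI v)
  have hsplit : coverWeight W I
      = ∑ v, (1 - t v) * ∑ u ∈ I, W v u + ∑ v, t v * ∑ u ∈ I, W v u := by
    rw [coverWeight, ← Finset.sum_add_distrib]
    exact Finset.sum_congr rfl fun v _ => by ring
  have hone : ∑ v, (1 - t v) = Fintype.card V - ∑ v, t v := by
    simp [Finset.sum_sub_distrib]
  linarith

/-- In a unit-weight instance, truncating a feasible solution at `1` keeps it feasible. -/
lemma Feasible.min_one [Fintype V] {W : V → V → ℝ} (hW : IsCollab W) (hu : UnitWeight W) {t : V → ℝ}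
    (ht : Feasible W t) : Feasible W fun v => min (t v) 1 := by
  have hnn : ∀ v, 0 ≤ min (t v) 1 := fun v => le_min (ht.1 v) zero_le_one
  refine ⟨hnn, fun v => ?_⟩
  by_cases h : ∃ u, W v u = 1 ∧ 1 ≤ t u
  · obtain ⟨u, h1, h2⟩ := h
    calc (1 : ℝ) = W v u * min (t u) 1 := by rw [h1, min_eq_right h2, one_mul]
      _ ≤ _ := Finset.single_le_sum (f := fun u => W v u * min (t u) 1)
        (fun x _ => mul_nonneg (hW.2.1 v x).1 (hnn x)) (Finset.mem_univ u)
  · push Not at h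
    refine (ht.2 v).trans (Finset.sum_le_sum fun u _ => ?_)
    have h01 : W v u = 0 ∨ W v u = 1 := by
      by_cases huv : v = u
      · right
        rw [huv, hW.2.2]
      · exact hu v u huv
    rcases h01 with h0 | h1
    · simp [h0]
    · exact (congrArg (W v u * ·) (min_eq_left (h u h1).le)).ge

lemma Feasible.one_le_sum [Fintype V] [Nonempty V] {W : V → V → ℝ} (hW : IsCollab W) {t : V → ℝ}
    (ht : Feasible W t) : 1 ≤ ∑ v, t v := by
  obtain ⟨v⟩ := ‹Nonempty V›
  exact (ht.2 v).trans
    (Finset.sum_le_sum fun u _ => mul_le_of_le_one_left (ht.1 u) (hW.2.1 v u).2)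

/-- Some feasible solution bounded by `1` is within a factor two of the optimum. -/
lemma exists_feasible_le_two_mul_OPT [Fintype V] [Nonempty V] {W : V → V → ℝ} (hW : IsCollab W)
    (hu : UnitWeight W) :
    ∃ t : V → ℝ, Feasible W t ∧ (∀ v, t v ≤ 1) ∧ ∑ v, t v ≤ 2 * OPT W := by
  have hne : {c : ℝ | ∃ θ : V → ℝ, Feasible W θ ∧ c = ∑ v, θ v}.Nonempty := by
    refine ⟨_, fun _ => 1, ⟨fun _ => zero_le_one, fun v => ?_⟩, rfl⟩
    calc (1 : ℝ) = W v v * 1 := by rw [hW.2.2, one_mul]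
      _ ≤ _ := Finset.single_le_sum (f := fun u => W v u * 1)
        (fun x _ => by simpa using (hW.2.1 v x).1) (Finset.mem_univ v)
  have hone : 1 ≤ OPT W := by
    refine le_csInf hne ?_
    rintro c ⟨t, ht, rfl⟩
    exact ht.one_le_sum hW
  obtain ⟨c, ⟨t, ht, rfl⟩, hc⟩ := exists_lt_of_csInf_lt hne
    (show OPT W < 2 * OPT W by linarith)
  refine ⟨_, ht.min_one hW hu, fun v => min_le_right _ _, ?_⟩
  exact (Finset.sum_le_sum fun v _ => min_le_left _ _).trans hc.le

lemma card_le_innerWeight [Fintype V] {W : V → V → ℝ} (hW : IsCollab W) (S : Finset V) :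
    #S ≤ innerWeight W S := by
  calc (#S : ℝ) = ∑ v ∈ S, W v v := by simp [hW.2.2]
    _ ≤ _ := Finset.sum_le_sum fun v hv =>
      Finset.single_le_sum (f := fun u => W v u) (fun x _ => (hW.2.1 v x).1) hv

lemma innerWeight_le_card_sq [Fintype V] {W : V → V → ℝ} (hW : IsCollab W) (S : Finset V) :
    innerWeight W S ≤ (#S : ℝ) ^ 2 := by
  calc innerWeight W S ≤ ∑ v ∈ S, ∑ u ∈ S, (1 : ℝ) :=
        Finset.sum_le_sum fun v _ => Finset.sum_le_sum fun u _ => (hW.2.1 v u).2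
    _ = (#S : ℝ) ^ 2 := by simp [sq]

/-- A fractional solution can be replaced by a set of about the same size with full cover
weight. -/
lemma exists_card_eq_ceil_coverWeight [Fintype V] [DecidableEq V] [Nonempty V]
    {W : V → V → ℝ} (hW : IsCollab W) {t : V → ℝ}
    (ht : Feasible W t) (ht1 : ∀ v, t v ≤ 1) :
    ∃ S : Finset V, #S = ⌈∑ v, t v⌉₊ ∧ Fintype.card V ≤ coverWeight W S := by
  have hpos := ht.one_le_sum hW
  have hle : ∑ v, t v ≤ Fintype.card V := by
    calc ∑ v, t v ≤ ∑ _v : V, (1 : ℝ) := Finset.sum_le_sum fun v _ => ht1 v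
      _ = Fintype.card V := by simp
  obtain ⟨S, hS, h⟩ := exists_card_eq_sum_mul_le (g := fun u => ∑ v, W v u)
    (fun u => Finset.sum_nonneg fun v _ => (hW.2.1 v u).1) ht.1 ht1
    (Nat.ceil_pos.2 (by linarith)) (Nat.ceil_le.2 hle) (Nat.le_ceil _)
  refine ⟨S, hS, ?_⟩
  calc (Fintype.card V : ℝ) = ∑ _v : V, (1 : ℝ) := by simp
    _ ≤ ∑ v, ∑ u, W v u * t u := Finset.sum_le_sum fun v _ => ht.2 v
    _ = ∑ u, t u * ∑ v, W v u := by
      rw [Finset.sum_comm]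
      refine Finset.sum_congr rfl fun u _ => ?_
      rw [Finset.mul_sum]
      exact Finset.sum_congr rfl fun v _ => mul_comm _ _
    _ ≤ _ := h
    _ = coverWeight W S := by rw [coverWeight, Finset.sum_comm]

/-- The numerical core: mixing `m` expensive vertices of cover weight `n` with an independent set
of expected size `X`, the balancing signal level still covers everything. -/
lemma le_balanced_level_mul {n m k q a X : ℝ} (hn : 1 ≤ n) (hm : 1 ≤ m) (ha : 0 ≤ a)
    (ha1 : a ≤ 1) (hq : q ≤ m ^ 2) (hmq : m ≤ q) (hX : X = 2 * m * √n)
    (hk : a * k ≤ X / 2) :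
    n ≤ ((1 - a) * m + X) / ((1 - a) * q + X) * (n - a * k + X) := by
  have hs : 1 ≤ √n := Real.one_le_sqrt.2 hn
  have hX0 : 0 < X := by rw [hX]; positivity
  have hXsq : X ^ 2 = 4 * m ^ 2 * n := by
    rw [hX, mul_pow, mul_pow, Real.sq_sqrt (by linarith)]
    norm_num
  have ha' : 0 ≤ 1 - a := by linarith
  have hden : 0 < (1 - a) * q + X := by
    have := mul_nonneg ha' (by linarith : (0 : ℝ) ≤ q)
    linarith
  have hnum : 0 ≤ (1 - a) * m + X := by
    have := mul_nonneg ha' (by linarith : (0 : ℝ) ≤ m)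
    linarith
  rw [div_mul_eq_mul_div, le_div_iff₀ hden]
  have hfirst : ((1 - a) * m + X) * (n + X / 2) ≤ ((1 - a) * m + X) * (n - a * k + X) :=
    mul_le_mul_of_nonneg_left (by linarith) hnum
  have hqn : (1 - a) * q * n ≤ m ^ 2 * n := by
    refine mul_le_mul_of_nonneg_right ?_ (by linarith)
    nlinarith
  have hpos : 0 ≤ (1 - a) * m * (n + X / 2) := by positivity
  nlinarith

/-- There is a universal constant `C > 0` such that every unit-weight
collaboration instance on `n ≥ 2` vertices admits a persuasive binary identity-independent
signaling scheme of cost at most `C · √n · OPT`. -/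
theorem statement0 :
    ∃ C : ℝ, 0 < C ∧
      ∀ (V : Type) [Fintype V] [DecidableEq V] (W : V → V → ℝ),
        IsCollab W → UnitWeight W → 2 ≤ Fintype.card V →
        ∃ D : Scheme V, D.sig.card ≤ 2 ∧ D.Persuasive W ∧
          D.cost ≤ C * Real.sqrt (Fintype.card V) * OPT W := by
  refine ⟨12, by norm_num, ?_⟩
  intro V _ _ W hW hu hcard
  have : Nonempty V := Fintype.card_pos_iff.1 (by omega)
  obtain ⟨t, ht, ht1, hopt⟩ := exists_feasible_le_two_mul_OPT hW hu
  obtain ⟨I, hind, hdom⟩ := exists_maximal_independent hW hu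
  obtain ⟨S, hS, hcov⟩ := exists_card_eq_ceil_coverWeight hW ht ht1
  have hQI := innerWeight_of_independent hW.2.2 hind
  have hFI := le_coverWeight_of_dominating hW ht ht1 hdom
  have hk1 := ht.one_le_sum hW
  have hkm : ∑ v, t v ≤ (#S : ℝ) := by rw [hS]; exact Nat.le_ceil _
  have hmk : (#S : ℝ) ≤ 2 * ∑ v, t v := by
    have := Nat.ceil_lt_add_one (a := ∑ v, t v) (by linarith)
    rw [hS]
    linarith
  have hn : (1 : ℝ) ≤ Fintype.card V := by exact_mod_cast (by omega : 1 ≤ Fintype.card V)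
  have hs : 1 ≤ √(Fintype.card V : ℝ) := Real.one_le_sqrt.2 hn
  set n : ℝ := (Fintype.card V : ℝ) with hn_def
  set k : ℝ := ∑ v, t v with hk_def
  have hbudget : 3 * #S * √n ≤ 12 * √n * OPT W := by nlinarith
  have hSn : (#S : ℝ) ≤ #S * √n := le_mul_of_one_le_right (by linarith) hs
  have hI0 : I.Nonempty := by
    obtain ⟨v⟩ := this
    by_contra hI
    have h := hdom v
    simp only [Finset.not_nonempty_iff_eq_empty.1 hI, Finset.sum_empty] at h
    linarith
  by_cases hIm : (#I : ℝ) ≤ 2 * #S * √n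
  · obtain ⟨D, hD, hpers, hcost⟩ := exists_scheme_of_two_sets hW.2.2 hI0.ne_empty
      (θ := 1) (a := 0) one_pos le_rfl le_rfl zero_le_one (by simp [hQI])
      (by
        have : n ≤ coverWeight W I := by
          calc n = ∑ _v : V, (1 : ℝ) := by simp [hn_def]
            _ ≤ _ := Finset.sum_le_sum fun v _ => hdom v
        simpa using this)
    refine ⟨D, hD, hpers, ?_⟩
    rw [hcost]
    linarith
  · push Not at hIm
    have hIpos : (0 : ℝ) < #I := by exact_mod_cast hI0.card_pos
    set X : ℝ := 2 * #S * √n with hX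
    set a : ℝ := X / #I with ha_def
    have hX0 : 0 < X := by nlinarith
    have haX : a * #I = X := div_mul_cancel₀ _ hIpos.ne'
    have ha0 : 0 ≤ a := by positivity
    have ha1 : a ≤ 1 := (div_le_one hIpos).2 hIm.le
    have hSI : S ≠ I := by
      rintro rfl
      linarith
    have hq := innerWeight_le_card_sq hW S
    have hmq := card_le_innerWeight hW S
    have hmain := le_balanced_level_mul (k := k) hn (hk1.trans hkm) ha0 ha1 hq hmq hX
      (by nlinarith)
    have ha' : 0 ≤ 1 - a := by linarith
    have hnum : 0 < (1 - a) * #S + X := by positivity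
    have hmono : (1 - a) * #S ≤ (1 - a) * innerWeight W S :=
      mul_le_mul_of_nonneg_left hmq ha'
    have hden : 0 < (1 - a) * innerWeight W S + X := by linarith
    set θ : ℝ := ((1 - a) * #S + X) / ((1 - a) * innerWeight W S + X) with hθ_def
    have hθ0 : 0 < θ := div_pos hnum hden
    have hθ1 : θ ≤ 1 := (div_le_one hden).2 (by linarith)
    obtain ⟨D, hD, hpers, hcost⟩ := exists_scheme_of_two_sets hW.2.2 hSI hθ0 hθ1 ha0 ha1
      (by rw [hQI, haX]; exact div_mul_cancel₀ _ hden.ne')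
      (by
        refine hmain.trans (mul_le_mul_of_nonneg_left ?_ hθ0.le)
        have h1 := mul_le_mul_of_nonneg_left hcov ha'
        have h2 := mul_le_mul_of_nonneg_left hFI ha0
        linarith)
    refine ⟨D, hD, hpers, ?_⟩
    rw [hcost, haX]
    have h1 : θ * ((1 - a) * #S + X) ≤ (1 - a) * #S + X := mul_le_of_le_one_left hnum.le hθ1
    have h2 : (1 - a) * (#S : ℝ) ≤ #S := mul_le_of_le_one_left (by linarith) (by linarith)
    linarith
end

section
/- There is a universal constant C > 0 such that for every collaboration instance on a finite vertex set V of size n ≥ 2, there exists a persuasive ternary identity-independent signaling scheme D with Cost(D) ≤ C · n^{3/4} · (OPT^IR)^{1/2}. -/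
open Finset

variable {V : Type*}

/-! ### Off-diagonal weights -/

/-- The off-diagonal part of a weight matrix. -/
def linkWeight [DecidableEq V] (W : V → V → ℝ) (v u : V) : ℝ := if u = v then 0 else W v u

/-- Total off-diagonal weight between two vertex sets, over ordered pairs. -/
def crossWeight [DecidableEq V] (W : V → V → ℝ) (A B : Finset V) : ℝ :=
  ∑ v ∈ A, ∑ u ∈ B, linkWeight W v u

/-- Weighted degree of a vertex. -/
def weightDeg [Fintype V] [DecidableEq V] (W : V → V → ℝ) (v : V) : ℝ := ∑ u, linkWeight W v u

section Weights

variable [Fintype V] [DecidableEq V] {W : V → V → ℝ}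

lemma linkWeight_nonneg (hW : IsCollab W) (v u : V) : 0 ≤ linkWeight W v u := by
  unfold linkWeight; split_ifs
  · exact le_rfl
  · exact (hW.2.1 v u).1

lemma linkWeight_le_one (hW : IsCollab W) (v u : V) : linkWeight W v u ≤ 1 := by
  unfold linkWeight; split_ifs
  · exact zero_le_one
  · exact (hW.2.1 v u).2

lemma linkWeight_comm (hW : IsCollab W) (v u : V) : linkWeight W v u = linkWeight W u v := by
  unfold linkWeight
  simp only [eq_comm (a := u) (b := v), hW.1 v u]

lemma sum_erase_eq_sum_linkWeight (s : V → ℝ) (v : V) :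
    ∑ u ∈ univ.erase v, W v u * s u = ∑ u, linkWeight W v u * s u := by
  rw [← Finset.sum_erase (s := univ) (a := v) (f := fun u => linkWeight W v u * s u)
    (by simp [linkWeight])]
  refine Finset.sum_congr rfl fun u hu => ?_
  simp [linkWeight, Finset.ne_of_mem_erase hu]

lemma crossWeight_nonneg (hW : IsCollab W) (A B : Finset V) : 0 ≤ crossWeight W A B :=
  Finset.sum_nonneg fun v _ => Finset.sum_nonneg fun u _ => linkWeight_nonneg hW v u

lemma crossWeight_comm (hW : IsCollab W) (A B : Finset V) :
    crossWeight W A B = crossWeight W B A := by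
  unfold crossWeight
  rw [Finset.sum_comm]
  exact Finset.sum_congr rfl fun u _ => Finset.sum_congr rfl fun v _ => linkWeight_comm hW v u

lemma crossWeight_self_le (hW : IsCollab W) (A : Finset V) :
    crossWeight W A A ≤ (A.card : ℝ) ^ 2 := by
  calc crossWeight W A A ≤ ∑ _v ∈ A, ∑ _u ∈ A, (1 : ℝ) :=
        Finset.sum_le_sum fun v _ => Finset.sum_le_sum fun u _ => linkWeight_le_one hW v u
    _ = (A.card : ℝ) ^ 2 := by simp [sq]

lemma sum_weightDeg_eq (A : Finset V) :
    ∑ v ∈ A, weightDeg W v = crossWeight W A A + crossWeight W A Aᶜ := by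
  unfold weightDeg crossWeight
  rw [← Finset.sum_add_distrib]
  exact Finset.sum_congr rfl fun v _ => (Finset.sum_add_sum_compl A _).symm

lemma weightDeg_nonneg (hW : IsCollab W) (v : V) : 0 ≤ weightDeg W v :=
  Finset.sum_nonneg fun u _ => linkWeight_nonneg hW v u

lemma crossWeight_self_le_total (hW : IsCollab W) (A : Finset V) :
    crossWeight W A A ≤ ∑ v, weightDeg W v := by
  have h1 := sum_weightDeg_eq (W := W) A
  have h2 := crossWeight_nonneg hW A Aᶜ
  have h3 : ∑ v ∈ A, weightDeg W v ≤ ∑ v, weightDeg W v :=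
    Finset.sum_le_univ_sum_of_nonneg (weightDeg_nonneg hW)
  linarith

lemma sum_weight_eq (hW : IsCollab W) (θ : V → ℝ) :
    ∑ v, ∑ u, W v u * θ u = ∑ u, θ u * (1 + weightDeg W u) := by
  rw [Finset.sum_comm]
  refine Finset.sum_congr rfl fun u _ => ?_
  rw [← Finset.sum_mul, mul_comm]
  congr 1
  have h : ∀ v, W v u = (if v = u then 1 else 0) + linkWeight W u v := by
    intro v
    unfold linkWeight
    by_cases hvu : v = u
    · subst hvu; simp [hW.2.2 v]
    · simp [hvu, hW.1 u v]
  simp only [h, Finset.sum_add_distrib, weightDeg]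
  simp

/-- A greedily chosen sparse subset of a set of vertices of bounded degree. -/
lemma exists_sparse_subset (hW : IsCollab W) (L : Finset V) (δ : ℝ)
    (hδ : ∀ v ∈ L, weightDeg W v ≤ δ) (r : ℕ) (hr : 2 * r ≤ L.card) :
    ∃ R ⊆ L, R.card = r ∧ crossWeight W R R * L.card ≤ 2 * δ * r ^ 2 := by
  induction r with
  | zero => exact ⟨∅, by simp, by simp, by simp [crossWeight]⟩
  | succ r ih =>
    obtain ⟨R, hRL, hRc, hRe⟩ := ih (by omega)
    have hcard : (L \ R).card + r = L.card := by
      rw [← hRc]; exact Finset.card_sdiff_add_card_eq_card hRL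
    have hne : (L \ R).Nonempty := by
      rw [← Finset.card_pos]; omega
    obtain ⟨v, hv, hmin⟩ :=
      Finset.exists_min_image (L \ R) (fun v => ∑ u ∈ R, linkWeight W v u) hne
    rw [Finset.mem_sdiff] at hv
    have hvdeg : 0 ≤ δ := (weightDeg_nonneg hW v).trans (hδ v hv.1)
    set m := ∑ u ∈ R, linkWeight W v u with hm
    have hm0 : 0 ≤ m := Finset.sum_nonneg fun u _ => linkWeight_nonneg hW v u
    have hup : ((L \ R).card : ℝ) * m ≤ r * δ := by
      calc ((L \ R).card : ℝ) * m = ∑ _w ∈ L \ R, m := by simp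
        _ ≤ ∑ w ∈ L \ R, ∑ u ∈ R, linkWeight W w u := Finset.sum_le_sum hmin
        _ = ∑ u ∈ R, ∑ w ∈ L \ R, linkWeight W w u := Finset.sum_comm
        _ ≤ ∑ u ∈ R, δ := by
          refine Finset.sum_le_sum fun u hu => ?_
          refine le_trans ?_ (hδ u (hRL hu))
          simp only [linkWeight_comm hW _ u]
          exact Finset.sum_le_univ_sum_of_nonneg (linkWeight_nonneg hW u)
        _ = r * δ := by simp [hRc]
    have hcross : crossWeight W (insert v R) (insert v R) = crossWeight W R R + 2 * m := by
      unfold crossWeight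
      rw [Finset.sum_insert hv.2, Finset.sum_insert hv.2]
      simp only [Finset.sum_insert hv.2, Finset.sum_add_distrib]
      have h1 : ∑ u ∈ R, linkWeight W u v = m :=
        Finset.sum_congr rfl fun u _ => linkWeight_comm hW u v
      have h2 : linkWeight W v v = 0 := by simp [linkWeight]
      rw [h1, h2, ← hm]; ring
    refine ⟨insert v R, Finset.insert_subset hv.1 hRL, by
      rw [Finset.card_insert_of_notMem hv.2, hRc], ?_⟩
    have hc1 : ((L \ R).card : ℝ) + r = L.card := by exact_mod_cast hcard
    have hc2 : 2 * ((r : ℝ) + 1) ≤ L.card := by exact_mod_cast hr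
    have hLm : (L.card : ℝ) * m ≤ 2 * (r * δ) := by nlinarith
    rw [hcross]
    push_cast
    nlinarith

end Weights

/-- A set of prescribed size on which `d` dominates its values elsewhere. -/
lemma exists_top_set [Fintype V] [DecidableEq V] (d : V → ℝ) (hd : ∀ v, 0 ≤ d v) (k : ℕ)
    (hk : k ≤ Fintype.card V) :
    ∃ S : Finset V, S.card = k ∧ ∃ t : ℝ, 0 ≤ t ∧ (∀ v ∈ S, t ≤ d v) ∧ ∀ v ∉ S, d v ≤ t := by
  induction k with
  | zero =>
    exact ⟨∅, rfl, ∑ v, d v, Finset.sum_nonneg fun v _ => hd v, by simp,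
      fun v _ => Finset.single_le_sum (fun u _ => hd u) (Finset.mem_univ v)⟩
  | succ k ih =>
    obtain ⟨S, hS, t, -, hin, hout⟩ := ih (by omega)
    have hne : Sᶜ.Nonempty := by
      rw [← Finset.card_pos, Finset.card_compl]; omega
    obtain ⟨v, hv, hmax⟩ := Finset.exists_max_image Sᶜ d hne
    rw [Finset.mem_compl] at hv
    refine ⟨insert v S, by rw [Finset.card_insert_of_notMem hv, hS], d v, hd v, ?_, ?_⟩
    · intro u hu
      rcases Finset.mem_insert.1 hu with rfl | hu
      · exact le_rfl
      · exact (hout v hv).trans (hin u hu)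
    · intro u hu
      rw [Finset.mem_insert, not_or] at hu
      exact hmax u (Finset.mem_compl.2 hu.2)

/-- A fractional selection with entries at most one is dominated by a genuine set. -/
lemma exists_set_sum_ge [Fintype V] [DecidableEq V] (d θ : V → ℝ) (hd : ∀ v, 0 ≤ d v)
    (h0 : ∀ v, 0 ≤ θ v) (h1 : ∀ v, θ v ≤ 1) (k : ℕ) (hk : k ≤ Fintype.card V)
    (hθ : ∑ v, θ v ≤ k) :
    ∃ S : Finset V, S.card = k ∧ ∑ v, θ v * d v ≤ ∑ v ∈ S, d v := by
  obtain ⟨S, hS, t, ht, hin, hout⟩ := exists_top_set d hd k hk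
  refine ⟨S, hS, ?_⟩
  have e1 : ∑ v ∈ S, θ v * d v ≤ ∑ v ∈ S, (d v + (θ v * t - t)) :=
    Finset.sum_le_sum fun v hv => by nlinarith [hin v hv, h1 v]
  have e2 : ∑ v ∈ Sᶜ, θ v * d v ≤ ∑ v ∈ Sᶜ, θ v * t :=
    Finset.sum_le_sum fun v hv =>
      mul_le_mul_of_nonneg_left (hout v (Finset.mem_compl.1 hv)) (h0 v)
  have e3 : ∑ v ∈ S, θ v * t + ∑ v ∈ Sᶜ, θ v * t = (∑ v, θ v) * t := by
    rw [Finset.sum_add_sum_compl, Finset.sum_mul]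
  rw [← Finset.sum_add_sum_compl S]
  simp only [Finset.sum_add_distrib, Finset.sum_sub_distrib, Finset.sum_const, hS,
    nsmul_eq_mul] at e1
  nlinarith

/-! ### Mixtures of two-valued signal profiles -/

/-- The profile with value `c` on `A` and `0` elsewhere. -/
noncomputable def twoValued [DecidableEq V] (A : Finset V) (c : ℝ) (v : V) : ℝ :=
  if v ∈ A then c else 0

/-- A finite mixture of signal profiles as a scheme. -/
lemma exists_scheme_mixture [Fintype V] {ι : Type*} [Fintype ι] (sig : Finset ℝ)
    (hsig : ∀ θ ∈ sig, 0 ≤ θ ∧ θ ≤ 1) (s : ι → V → ℝ) (hs : ∀ i v, s i v ∈ sig)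
    (q : ι → ℝ) (hq : ∀ i, 0 ≤ q i) (hq1 : ∑ i, q i = 1) :
    ∃ D : Scheme V, D.sig = sig ∧ ∀ f, D.exp f = ∑ i, q i * f (s i) := by
  classical
  have key : ∀ f : (V → ℝ) → ℝ,
      ∑ x ∈ univ.image s, (∑ i with s i = x, q i) * f x = ∑ i, q i * f (s i) := by
    intro f
    rw [← Finset.sum_fiberwise_of_maps_to (s := univ) (t := univ.image s) (g := s)
      (fun i hi => Finset.mem_image_of_mem s hi)]
    refine Finset.sum_congr rfl fun x _ => ?_
    rw [Finset.sum_mul]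
    refine Finset.sum_congr rfl fun i hi => ?_
    rw [(Finset.mem_filter.1 hi).2]
  refine ⟨{ sig := sig, sig_mem := hsig, supp := univ.image s, val_mem := ?_,
            p := fun x => ∑ i with s i = x, q i, p_nonneg := ?_, p_sum := ?_ }, rfl, key⟩
  · intro x hx v
    obtain ⟨i, -, rfl⟩ := Finset.mem_image.1 hx
    exact hs i v
  · exact fun x _ => Finset.sum_nonneg fun i _ => hq i
  · simpa [hq1] using key fun _ => 1

section Mixture

variable [Fintype V] [DecidableEq V]

/-- Contribution of a single signal profile to the slack of `θ`. -/
noncomputable def profileSlack (W : V → V → ℝ) (θ : ℝ) (s : V → ℝ) : ℝ :=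
  ∑ v, if s v = θ then ∑ u, linkWeight W v u * s u - (1 - θ) else 0

lemma Scheme.slack_eq_exp (D : Scheme V) (W : V → V → ℝ) (θ : ℝ) :
    D.slack W θ = D.exp (profileSlack W θ) := by
  unfold Scheme.slack Scheme.Contrib Scheme.Num Scheme.exp profileSlack
  rw [Finset.mul_sum, ← Finset.sum_sub_distrib]
  refine Finset.sum_congr rfl fun s _ => ?_
  rw [mul_left_comm, ← mul_sub, Finset.mul_sum, ← Finset.sum_sub_distrib]
  congr 1
  refine Finset.sum_congr rfl fun v _ => ?_
  rw [sum_erase_eq_sum_linkWeight]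
  split_ifs <;> ring

lemma sum_linkWeight_twoValued (W : V → V → ℝ) (A : Finset V) (c : ℝ) (v : V) :
    ∑ u, linkWeight W v u * twoValued A c u = c * ∑ u ∈ A, linkWeight W v u := by
  simp [twoValued, Finset.sum_mul, mul_comm c, Finset.sum_ite_mem]

lemma sum_twoValued (A : Finset V) (c : ℝ) : ∑ v, twoValued A c v = c * A.card := by
  simp [twoValued, Finset.sum_ite_mem, mul_comm]

lemma profileSlack_twoValued_of_pos (W : V → V → ℝ) (A : Finset V) {c θ : ℝ} (hθ : 0 < θ) :
    profileSlack W θ (twoValued A c) =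
      if c = θ then c * crossWeight W A A - (1 - c) * A.card else 0 := by
  unfold profileSlack
  simp only [sum_linkWeight_twoValued]
  have h : ∀ v, (twoValued A c v = θ) ↔ (v ∈ A ∧ c = θ) := by
    intro v
    unfold twoValued
    split_ifs with hv
    · simp [hv]
    · simp [hv, hθ.ne]
  simp only [h]
  split_ifs with hc
  · subst hc
    simp only [and_true, Finset.sum_ite_mem, Finset.univ_inter, Finset.sum_sub_distrib,
      ← Finset.mul_sum, crossWeight, Finset.sum_const, nsmul_eq_mul]
    ring
  · simp [hc]

lemma profileSlack_twoValued_zero (W : V → V → ℝ) (A : Finset V) {c : ℝ} (hc : 0 < c) :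
    profileSlack W 0 (twoValued A c) = c * crossWeight W Aᶜ A - (Aᶜ.card : ℝ) := by
  unfold profileSlack
  simp only [sum_linkWeight_twoValued]
  have h : ∀ v, (twoValued A c v = 0) ↔ v ∈ Aᶜ := by
    intro v
    unfold twoValued
    split_ifs with hv
    · simp [hv, hc.ne']
    · simp [hv]
  simp only [h, Finset.sum_ite_mem, Finset.univ_inter, Finset.sum_sub_distrib,
    ← Finset.mul_sum, crossWeight]
  simp

/-- Pooling everyone on one signal is persuasive. -/
lemma exists_uniform_scheme (W : V → V → ℝ) (hW : IsCollab W) (hn : 0 < Fintype.card V) :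
    ∃ D : Scheme V, D.sig.card ≤ 3 ∧ D.Persuasive W ∧
      D.cost = (Fintype.card V : ℝ) ^ 2 / (Fintype.card V + ∑ v, weightDeg W v) := by
  have hn' : (0 : ℝ) < Fintype.card V := by exact_mod_cast hn
  set n : ℝ := (Fintype.card V : ℝ) with hndef
  set M := ∑ v, weightDeg W v with hM
  have hM0 : 0 ≤ M := Finset.sum_nonneg fun v _ => weightDeg_nonneg hW v
  have hpos : 0 < n + M := by linarith
  set c := n / (n + M) with hc
  have hc0 : 0 < c := div_pos hn' hpos
  have hc1 : c ≤ 1 := by rw [hc, div_le_one hpos]; linarith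
  have hcM : c * (n + M) = n := by rw [hc]; field_simp
  obtain ⟨D, hsig, hexp⟩ := exists_scheme_mixture (V := V) (ι := Unit) {c}
    (by simp [hc0.le, hc1]) (fun _ => twoValued univ c) (by simp [twoValued])
    (fun _ => 1) (by simp) (by simp)
  refine ⟨D, by simp [hsig], ⟨?_, ?_⟩, ?_⟩
  · intro θ _ hθ0
    rw [D.slack_eq_exp, hexp]
    simp only [profileSlack_twoValued_of_pos W _ hθ0]
    have hcw : crossWeight W univ univ = M := rfl
    simp only [hcw, Finset.card_univ, ← hndef]
    split_ifs <;> simp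
    linarith
  · intro h
    rw [hsig, Finset.mem_singleton] at h
    exact absurd h hc0.ne
  · unfold Scheme.cost
    rw [hexp]
    simp only [sum_twoValued, Finset.card_univ, ← hndef]
    simp [hc]; ring

/-- A mixture that places signal `α` on `S` or on `R`, or signal `β` on the complement of `S`. -/
lemma exists_ternary_scheme (W : V → V → ℝ) (S R : Finset V) {α β q₁ q₂ q₃ : ℝ}
    (hα0 : 0 < α) (hα1 : α ≤ 1) (hβ0 : 0 < β) (hβ1 : β ≤ 1)
    (hq₁ : 0 ≤ q₁) (hq₂ : 0 ≤ q₂) (hq₃ : 0 ≤ q₃) (hq : q₁ + q₂ + q₃ = 1)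
    (hα : q₁ * (α * crossWeight W S S - (1 - α) * S.card)
      + q₂ * (α * crossWeight W R R - (1 - α) * R.card) = 0)
    (hβ : β * crossWeight W Sᶜ Sᶜ - (1 - β) * (Sᶜ.card : ℝ) = 0)
    (h0 : 0 ≤ q₁ * (α * crossWeight W Sᶜ S - (Sᶜ.card : ℝ))
      + q₂ * (α * crossWeight W Rᶜ R - (Rᶜ.card : ℝ))
      + q₃ * (β * crossWeight W S Sᶜ - S.card)) :
    ∃ D : Scheme V, D.sig.card ≤ 3 ∧ D.Persuasive W ∧
      D.cost = q₁ * (α * S.card) + q₂ * (α * R.card) + q₃ * (β * (Sᶜ.card : ℝ)) := by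
  obtain ⟨D, hsig, hexp⟩ := exists_scheme_mixture (V := V) (ι := Fin 3) {0, α, β}
    (by simp [hα0.le, hα1, hβ0.le, hβ1])
    ![twoValued S α, twoValued R α, twoValued Sᶜ β]
    (by
      intro i v
      fin_cases i <;> simp only [twoValued, Fin.isValue, Fin.zero_eta, Fin.mk_one,
        Fin.reduceFinMk, Matrix.cons_val] <;> split_ifs <;> simp)
    ![q₁, q₂, q₃]
    (by intro i; fin_cases i <;> simpa)
    (by simpa [Fin.sum_univ_three] using hq)
  refine ⟨D, by rw [hsig]; exact Finset.card_le_three, ⟨?_, ?_⟩, ?_⟩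
  · intro θ _ hθ0
    rw [D.slack_eq_exp, hexp]
    simp only [Fin.sum_univ_three, Matrix.cons_val, profileSlack_twoValued_of_pos W _ hθ0, hβ]
    split_ifs <;> simp <;> linarith
  · intro _
    rw [D.slack_eq_exp, hexp]
    simp only [Fin.sum_univ_three, Matrix.cons_val, profileSlack_twoValued_zero W _ hα0,
      profileSlack_twoValued_zero W _ hβ0, compl_compl]
    exact h0
  · unfold Scheme.cost
    rw [hexp]
    simp only [Fin.sum_univ_three, Matrix.cons_val, sum_twoValued]

end Mixture

/-! ### Choice of parameters -/

lemma neg_mul_le_mul_of_le {a c y z : ℝ} (ha : 0 ≤ a) (hac : a ≤ c) (hy : 0 ≤ y)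
    (hyz : -y ≤ z) : -(c * y) ≤ a * z := by
  nlinarith [mul_le_mul_of_nonneg_right hac hy, mul_le_mul_of_nonneg_left hyz ha]

lemma feasible_one [Fintype V] {W : V → V → ℝ} (hW : IsCollab W) : Feasible W fun _ => 1 := by
  refine ⟨fun _ => zero_le_one, fun v => ?_⟩
  calc (1 : ℝ) = W v v * 1 := by rw [hW.2.2 v, mul_one]
    _ ≤ ∑ u, W v u * 1 := Finset.single_le_sum
      (fun u _ => mul_nonneg (hW.2.1 v u).1 zero_le_one) (Finset.mem_univ v)

lemma one_le_OPTIR [Fintype V] {W : V → V → ℝ} (hW : IsCollab W) (hn : 0 < Fintype.card V) :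
    1 ≤ OPTIR W := by
  refine le_csInf ⟨_, fun _ => 1, feasible_one hW, fun _ => le_rfl, rfl⟩ ?_
  rintro c ⟨θ, hθ, -, rfl⟩
  obtain ⟨v⟩ := Fintype.card_pos_iff.1 hn
  refine (hθ.2 v).trans (Finset.sum_le_sum fun u _ => ?_)
  exact mul_le_of_le_one_left (hθ.1 u) (hW.2.1 v u).2

section Parameters

variable [Fintype V] [DecidableEq V] {W : V → V → ℝ}

/-- A ternary scheme of cost at most `T` from a small set `S` covering almost everything,
provided the slack of signal `1 - ε` on `S` can be balanced against that on `R`. -/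
lemma exists_scheme_of_balance (hW : IsCollab W) (S R : Finset V) {T ε ρ : ℝ}
    (hT : 0 < T) (hTn : T < Fintype.card V)
    (hM : (∑ v, weightDeg W v) * T ≤ (Fintype.card V : ℝ) ^ 2)
    (hS1 : 1 ≤ S.card) (hS2 : 64 * (S.card : ℝ) ^ 2 ≤ T)
    (hS3 : (Fintype.card V : ℝ) ≤ ∑ v ∈ S, (1 + weightDeg W v))
    (hε : 0 ≤ ε) (hε' : 128 * (Fintype.card V : ℝ) * ε ≤ T)
    (hρ : 0 ≤ ρ) (hρ' : 128 * (Fintype.card V : ℝ) * ρ ≤ T)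
    (hR : 8 * (R.card : ℝ) ≤ T)
    (hbal : (1 - ρ) * ((1 - ε) * crossWeight W S S - ε * S.card)
      + ρ * ((1 - ε) * crossWeight W R R - ε * R.card) = 0) :
    ∃ D : Scheme V, D.sig.card ≤ 3 ∧ D.Persuasive W ∧ D.cost ≤ T := by
  have hcomplS : (Sᶜ.card : ℝ) + S.card = Fintype.card V := by
    exact_mod_cast Finset.card_compl_add_card S
  have hcomplR : (Rᶜ.card : ℝ) + R.card = Fintype.card V := by
    exact_mod_cast Finset.card_compl_add_card R
  have hR0 : (0 : ℝ) ≤ R.card := Nat.cast_nonneg _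
  have hk1 : (1 : ℝ) ≤ S.card := by exact_mod_cast hS1
  have hE0 := crossWeight_nonneg hW S S
  have hE1 := crossWeight_self_le hW S
  have hM'0 := crossWeight_nonneg hW Sᶜ Sᶜ
  have hM'1 := crossWeight_self_le_total hW Sᶜ
  have hF : (Fintype.card V : ℝ) ≤ S.card + (crossWeight W S S + crossWeight W S Sᶜ) := by
    rw [← sum_weightDeg_eq]
    simpa [Finset.sum_add_distrib] using hS3
  have hcomm := crossWeight_comm hW Sᶜ S
  have hG0 := crossWeight_nonneg hW Rᶜ R
  set n : ℝ := (Fintype.card V : ℝ)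
  set k : ℝ := (S.card : ℝ)
  set N : ℝ := (Sᶜ.card : ℝ)
  set M := ∑ v, weightDeg W v
  set M' := crossWeight W Sᶜ Sᶜ
  set E := crossWeight W S S
  set F := crossWeight W S Sᶜ
  set G := crossWeight W Rᶜ R
  have hn : 0 < n := hT.trans hTn
  have hkT : 64 * k ≤ T := by nlinarith
  have hN : n ≤ 2 * N := by linarith
  have hN0 : 0 < N := by linarith
  have hε1 : 128 * ε ≤ 1 := by nlinarith
  have hρ1 : 128 * ρ ≤ 1 := by nlinarith
  have hNM : 0 < N + M' := by linarith
  set β := N / (N + M') with hβ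
  set q := T * (N + M') / (8 * n * N) with hq
  have hβ0 : 0 < β := div_pos hN0 hNM
  have hβ1 : β ≤ 1 := by rw [hβ, div_le_one hNM]; linarith
  have hβM : β * (N + M') = N := by rw [hβ]; field_simp
  have hqβ : q * β = T / (8 * n) := by rw [hq, hβ]; field_simp
  have hq0 : 0 ≤ q := by positivity
  have hq1 : q ≤ 1 := by
    rw [hq, div_le_one (by positivity)]
    have a1 : T * (N + M') ≤ 2 * n ^ 2 := by
      have b1 : T * M' ≤ T * M := mul_le_mul_of_nonneg_left hM'1 hT.le
      have b2 : T * N ≤ n * n :=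
        mul_le_mul hTn.le (by linarith) hN0.le hn.le
      linarith
    have a2 : n * n ≤ n * (2 * N) := mul_le_mul_of_nonneg_left hN hn.le
    have a3 : 0 ≤ n * n := by positivity
    linarith
  have hqβn : q * β * n = T / 8 := by rw [hqβ]; field_simp
  have hqβ0 : 0 ≤ q * β := by positivity
  obtain ⟨D, hD1, hD2, hD3⟩ := exists_ternary_scheme W S R (α := 1 - ε) (β := β)
    (q₁ := (1 - q) * (1 - ρ)) (q₂ := (1 - q) * ρ) (q₃ := q)
    (by linarith) (by linarith) hβ0 hβ1
    (mul_nonneg (by linarith) (by linarith)) (mul_nonneg (by linarith) hρ) hq0 (by ring)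
    (by linear_combination (1 - q) * hbal)
    (by change β * M' - (1 - β) * N = 0; linarith)
    (by
      rw [hcomm]
      have t1 : -(ε * n + E) ≤ (1 - ε) * F - N := by
        have a1 : (1 - ε) * (N - E) ≤ (1 - ε) * F :=
          mul_le_mul_of_nonneg_left (by linarith) (by linarith)
        have a2 : 0 ≤ ε * (E + (n - N)) := mul_nonneg hε (by linarith)
        linarith
      have t1' : -(ε * n + E) ≤ (1 - q) * (1 - ρ) * ((1 - ε) * F - N) := by
        have a0 : 0 ≤ (1 - q) * (1 - ρ) := mul_nonneg (by linarith) (by linarith)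
        have a1 : (1 - q) * (1 - ρ) ≤ 1 := mul_le_one₀ (by linarith) (by linarith) (by linarith)
        simpa using neg_mul_le_mul_of_le a0 a1 (by positivity) t1
      have t2 : -n ≤ (1 - ε) * G - (Rᶜ.card : ℝ) := by
        have : 0 ≤ (1 - ε) * G := mul_nonneg (by linarith) hG0
        linarith
      have t2' : -(ρ * n) ≤ (1 - q) * ρ * ((1 - ε) * G - (Rᶜ.card : ℝ)) := by
        have a0 : 0 ≤ (1 - q) * ρ := mul_nonneg (by linarith) hρ
        exact neg_mul_le_mul_of_le a0 (mul_le_of_le_one_left hρ (by linarith)) hn.le t2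
      have t3 : T / 16 - k ≤ q * (β * F - k) := by
        have a1 : n / 2 ≤ F := by linarith
        have a2 : q * β * (n / 2) ≤ q * β * F := mul_le_mul_of_nonneg_left a1 hqβ0
        have a3 : q * k ≤ k := mul_le_of_le_one_left (by linarith) hq1
        linarith
      linarith)
  refine ⟨D, hD1, hD2, ?_⟩
  rw [hD3]
  have c1 : (1 - q) * (1 - ρ) * ((1 - ε) * k) ≤ k := by
    have a1 : (1 - q) * (1 - ρ) ≤ 1 := mul_le_one₀ (by linarith) (by linarith) (by linarith)
    have a2 : (1 - ε) * k ≤ k := mul_le_of_le_one_left (by linarith) (by linarith)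
    exact (mul_le_of_le_one_left (mul_nonneg (by linarith) (by linarith)) a1).trans a2
  have c2 : (1 - q) * ρ * ((1 - ε) * R.card) ≤ R.card := by
    have a1 : (1 - q) * ρ ≤ 1 := mul_le_one₀ (by linarith) hρ (by linarith)
    have a2 : (1 - ε) * R.card ≤ R.card := mul_le_of_le_one_left hR0 (by linarith)
    exact (mul_le_of_le_one_left (mul_nonneg (by linarith) hR0) a1).trans a2
  have c3 : q * (β * N) ≤ T / 8 := by
    have a1 : q * β * N ≤ q * β * n := mul_le_mul_of_nonneg_left (by linarith) hqβ0
    linarith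
  linarith

/-- At least half of the vertices have degree at most four times the average. -/
lemma exists_low_degree_set (hW : IsCollab W) {T : ℝ} (hT : 0 < T)
    (hM : (∑ v, weightDeg W v) * T ≤ (Fintype.card V : ℝ) ^ 2)
    (hn : 0 < Fintype.card V) :
    ∃ L : Finset V, Fintype.card V ≤ 2 * L.card ∧
      ∀ v ∈ L, weightDeg W v ≤ 4 * Fintype.card V / T := by
  have hn' : (0 : ℝ) < Fintype.card V := by exact_mod_cast hn
  set n : ℝ := (Fintype.card V : ℝ) with hndef
  set L : Finset V := univ.filter fun v => weightDeg W v ≤ 4 * n / T with hL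
  refine ⟨L, ?_, fun v hv => (Finset.mem_filter.1 hv).2⟩
  have h1 : (Lᶜ.card : ℝ) * (4 * n / T) ≤ ∑ v, weightDeg W v := by
    calc (Lᶜ.card : ℝ) * (4 * n / T) = ∑ _v ∈ Lᶜ, 4 * n / T := by simp
      _ ≤ ∑ v ∈ Lᶜ, weightDeg W v := by
        refine Finset.sum_le_sum fun v hv => ?_
        simp only [hL, Finset.mem_compl, Finset.mem_filter, Finset.mem_univ, true_and,
          not_le] at hv
        exact hv.le
      _ ≤ ∑ v, weightDeg W v := Finset.sum_le_univ_sum_of_nonneg (weightDeg_nonneg hW)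
  have h2 : (Lᶜ.card : ℝ) * (4 * n) ≤ n ^ 2 := by
    calc (Lᶜ.card : ℝ) * (4 * n) = (Lᶜ.card : ℝ) * (4 * n / T) * T := by field_simp
      _ ≤ (∑ v, weightDeg W v) * T := mul_le_mul_of_nonneg_right h1 hT.le
      _ ≤ n ^ 2 := hM
  have h3 : 4 * (Lᶜ.card : ℝ) ≤ n := by nlinarith
  have h4 : 4 * Lᶜ.card ≤ Fintype.card V := by rw [hndef] at h3; exact_mod_cast h3
  have h5 := Finset.card_compl_add_card L
  omega

/-- A ternary scheme of cost at most `T` from a small set `S` covering almost everything. -/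
lemma exists_scheme_of_cover (hW : IsCollab W) (S : Finset V) {T : ℝ}
    (hT : 0 < T) (hTn : T < Fintype.card V)
    (hM : (∑ v, weightDeg W v) * T ≤ (Fintype.card V : ℝ) ^ 2)
    (hS1 : 1 ≤ S.card)
    (hS2 : 2 ^ 28 * (Fintype.card V : ℝ) ^ 3 * (S.card : ℝ) ^ 2 ≤ T ^ 4)
    (hS3 : (Fintype.card V : ℝ) ≤ ∑ v ∈ S, (1 + weightDeg W v)) :
    ∃ D : Scheme V, D.sig.card ≤ 3 ∧ D.Persuasive W ∧ D.cost ≤ T := by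
  have hn0 : (0 : ℝ) < Fintype.card V := hT.trans hTn
  have hnN : 0 < Fintype.card V := by exact_mod_cast hn0
  have hn1 : (1 : ℝ) ≤ Fintype.card V := by exact_mod_cast hnN
  have hk1 : (1 : ℝ) ≤ S.card := by exact_mod_cast hS1
  have hE0 := crossWeight_nonneg hW S S
  have hE1 := crossWeight_self_le hW S
  have hST : 64 * (S.card : ℝ) ^ 2 ≤ T := by
    have h : T ^ 4 ≤ T * (Fintype.card V : ℝ) ^ 3 := by
      calc T ^ 4 = T * T ^ 3 := by ring
        _ ≤ T * (Fintype.card V : ℝ) ^ 3 := by gcongr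
    have h' : 2 ^ 28 * (S.card : ℝ) ^ 2 ≤ T := by
      refine le_of_mul_le_mul_right ?_ (pow_pos hn0 3)
      linarith
    nlinarith
  have hbalance := fun (R : Finset V) (ε ρ : ℝ) =>
    exists_scheme_of_balance hW S R (ε := ε) (ρ := ρ) hT hTn hM hS1 hST hS3
  obtain ⟨L, hL1, hL2⟩ := exists_low_degree_set hW hT hM hnN
  have hL1' : (Fintype.card V : ℝ) ≤ 2 * L.card := by exact_mod_cast hL1
  have hsparse := exists_sparse_subset hW L _ hL2
  set n : ℝ := (Fintype.card V : ℝ) with hndef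
  set k : ℝ := (S.card : ℝ)
  set E := crossWeight W S S
  set ε := T / (128 * n) with hε
  have hε0 : 0 < ε := by positivity
  have hεn : 128 * n * ε = T := by rw [hε]; field_simp
  have hε1 : 128 * ε ≤ 1 := by nlinarith
  by_cases hA : (1 - ε) * E - ε * k ≤ 0
  · have hEk : 0 < E + k := by linarith
    have hle : E / (E + k) ≤ ε := by
      rw [div_le_iff₀ hEk]; linarith
    refine hbalance ∅ (E / (E + k)) 0 (by positivity) ?_ le_rfl
      (by simpa using hT.le) (by simpa using hT.le) ?_
    · calc 128 * n * (E / (E + k)) ≤ 128 * n * ε := by gcongr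
        _ ≤ T := hεn.le
    · field_simp
      ring
  · push Not at hA
    have hT2 : 2 ^ 14 * n ≤ T ^ 2 := by
      refine le_of_sq_le_sq ?_ (by positivity)
      have a1 : n ^ 2 * 1 ≤ n ^ 2 * n := by gcongr
      have a2 : n ^ 3 * 1 ≤ n ^ 3 * k ^ 2 := by gcongr; exact one_le_pow₀ hk1
      linarith
    set y := T ^ 2 / (4096 * n) with hy
    have hyn : y * (4096 * n) = T ^ 2 := by rw [hy]; field_simp
    have hy4 : 4 ≤ y := by rw [hy, le_div_iff₀ (by positivity)]; linarith
    have hyT : 4096 * y ≤ T := by nlinarith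
    set r := ⌊y⌋₊ with hr
    have hry : (r : ℝ) ≤ y := Nat.floor_le (by linarith)
    have hyr : y ≤ 2 * r := by linarith [Nat.lt_floor_add_one y]
    have hrL : 2 * r ≤ L.card := by
      have : (2 : ℝ) * r ≤ L.card := by linarith
      exact_mod_cast this
    obtain ⟨R, -, hRc, hRe⟩ := hsparse r hrL
    have hR0 := crossWeight_nonneg hW R R
    have hRcard : (R.card : ℝ) = r := by rw [hRc]
    have hbal := hbalance R ε
    rw [hRcard] at hbal
    set e := crossWeight W R R
    have he : e ≤ ε * r / 2 := by
      have a1 : e * n ≤ 16 * n / T * r ^ 2 := by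
        calc e * n ≤ e * (2 * L.card) := by gcongr
          _ ≤ 2 * (2 * (4 * n / T) * r ^ 2) := by linarith
          _ = 16 * n / T * r ^ 2 := by ring
      have a2 : e ≤ 16 / T * r ^ 2 := by
        refine le_of_mul_le_mul_right (a1.trans_eq ?_) hn0
        ring
      have a3 : 16 / T * (r : ℝ) ^ 2 ≤ 16 / T * (r * y) := by
        rw [sq]; gcongr
      have a4 : 16 / T * (r * y) = ε * r / 2 := by
        rw [hy, hε]; field_simp; ring
      linarith
    set A := (1 - ε) * E - ε * k with hAdef
    set B := ε * r - (1 - ε) * e with hBdef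
    have hB : ε * y / 4 ≤ B := by
      have a1 : 0 ≤ ε * e := mul_nonneg hε0.le hR0
      have a2 : ε * y ≤ ε * (2 * r) := mul_le_mul_of_nonneg_left hyr hε0.le
      linarith
    have hTB : 128 * n * k ^ 2 ≤ T * B := by
      have a1 : T * (ε * y / 4) = T ^ 4 / (2 ^ 21 * n ^ 2) := by
        rw [hy, hε]; field_simp; norm_num
      have a2 : 128 * n * k ^ 2 ≤ T ^ 4 / (2 ^ 21 * n ^ 2) := by
        rw [le_div_iff₀ (by positivity)]; linarith
      exact (a2.trans_eq a1.symm).trans (mul_le_mul_of_nonneg_left hB hT.le)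
    have hB0 : 0 < B := lt_of_lt_of_le (by positivity) hB
    have hAk : A ≤ k ^ 2 := by
      have : 0 ≤ ε * E + ε * k := by positivity
      linarith
    refine hbal (A / (A + B)) hε0.le hεn.le (by positivity) ?_ (by linarith) ?_
    · rw [mul_div_assoc', div_le_iff₀ (by positivity)]
      have : 128 * n * A ≤ 128 * n * k ^ 2 := by gcongr
      have := mul_pos hT hA
      linarith
    · have h1 : (1 - ε) * e - ε * r = -B := by rw [hBdef]; ring
      rw [h1]
      have : A + B ≠ 0 := by positivity
      field_simp
      ring

/-- A set of size comparable to the optimum whose closed degrees add up to the vertex count. -/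
lemma exists_cover (hW : IsCollab W) (hn : 0 < Fintype.card V)
    (hk : 3 * OPTIR W ≤ Fintype.card V) :
    ∃ S : Finset V, 1 ≤ S.card ∧ (S.card : ℝ) ≤ 3 * OPTIR W ∧
      (Fintype.card V : ℝ) ≤ ∑ v ∈ S, (1 + weightDeg W v) := by
  have hx := one_le_OPTIR hW hn
  obtain ⟨c, ⟨θ, hθ, hθ1, rfl⟩, hc⟩ :
      ∃ c ∈ {c : ℝ | ∃ θ : V → ℝ, Feasible W θ ∧ (∀ v, θ v ≤ 1) ∧ c = ∑ v, θ v},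
        c < OPTIR W + 1 :=
    exists_lt_of_csInf_lt ⟨_, fun _ => 1, feasible_one hW, fun _ => le_rfl, rfl⟩
      (lt_add_one (OPTIR W))
  have hsum0 : 0 ≤ ∑ v, θ v := Finset.sum_nonneg fun v _ => hθ.1 v
  have hsum : (Fintype.card V : ℝ) ≤ ∑ v, θ v * (1 + weightDeg W v) := by
    rw [← sum_weight_eq hW]
    calc (Fintype.card V : ℝ) = ∑ _v : V, (1 : ℝ) := by simp
      _ ≤ _ := Finset.sum_le_sum fun v _ => hθ.2 v
  have hceil := Nat.ceil_lt_add_one hsum0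
  have hk3 : (⌈∑ v, θ v⌉₊ : ℝ) ≤ 3 * OPTIR W := by linarith
  obtain ⟨S, hSc, hS⟩ := exists_set_sum_ge (fun v => 1 + weightDeg W v) θ
    (fun v => by linarith [weightDeg_nonneg hW v]) hθ.1 hθ1 ⌈∑ v, θ v⌉₊
    (by exact_mod_cast hk3.trans hk) (Nat.le_ceil _)
  refine ⟨S, ?_, by rw [hSc]; exact hk3, hsum.trans hS⟩
  rw [Nat.one_le_iff_ne_zero, Ne, Finset.card_eq_zero]
  rintro rfl
  have : (0 : ℝ) < Fintype.card V := by exact_mod_cast hn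
  simp only [Finset.sum_empty] at hS
  linarith

end Parameters

/-- There is a universal constant `C > 0` such that every collaboration
instance on `n ≥ 2` vertices admits a persuasive ternary identity-independent signaling
scheme of cost at most `C · n^(3/4) · (OPT^IR)^(1/2)`. -/
theorem statement2 :
    ∃ C : ℝ, 0 < C ∧
      ∀ (V : Type) [Fintype V] [DecidableEq V] (W : V → V → ℝ),
        IsCollab W → 2 ≤ Fintype.card V →
        ∃ D : Scheme V, D.sig.card ≤ 3 ∧ D.Persuasive W ∧
          D.cost ≤ C * (Fintype.card V : ℝ) ^ ((3 : ℝ) / 4) * OPTIR W ^ ((1 : ℝ) / 2) := by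
  refine ⟨256, by norm_num, fun V _ _ W hW hn2 => ?_⟩
  have hnN : 0 < Fintype.card V := by omega
  have hn0 : (0 : ℝ) < Fintype.card V := by exact_mod_cast hnN
  have hx := one_le_OPTIR hW hnN
  have hx0 : 0 < OPTIR W := by linarith
  set T : ℝ := 256 * (Fintype.card V : ℝ) ^ ((3 : ℝ) / 4) * OPTIR W ^ ((1 : ℝ) / 2) with hTdef
  have hT : 0 < T := by positivity
  have hT4 : T ^ 4 = 2 ^ 32 * (Fintype.card V : ℝ) ^ 3 * OPTIR W ^ 2 := by
    rw [hTdef, mul_pow, mul_pow, ← Real.rpow_mul_natCast hn0.le,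
      ← Real.rpow_mul_natCast hx0.le]
    norm_num
  by_cases huniform : Fintype.card V ≤ T ∨
      (Fintype.card V : ℝ) ^ 2 ≤ (∑ v, weightDeg W v) * T
  · obtain ⟨D, hD1, hD2, hD3⟩ := exists_uniform_scheme W hW hnN
    refine ⟨D, hD1, hD2, ?_⟩
    have hM0 : 0 ≤ ∑ v, weightDeg W v := Finset.sum_nonneg fun v _ => weightDeg_nonneg hW v
    rw [hD3, div_le_iff₀ (by positivity)]
    rcases huniform with h | h <;> nlinarith
  · push Not at huniform
    obtain ⟨hTn, hM⟩ := huniform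
    have hxT : 3 * OPTIR W ≤ Fintype.card V := by
      have h1 : T ^ 4 ≤ (Fintype.card V : ℝ) ^ 4 := by gcongr
      have h2 : 2 ^ 32 * OPTIR W ^ 2 ≤ Fintype.card V := by
        refine le_of_mul_le_mul_right ?_ (pow_pos hn0 3)
        linarith
      nlinarith
    obtain ⟨S, hS1, hS2, hS3⟩ := exists_cover hW hnN hxT
    refine exists_scheme_of_cover hW S hT hTn hM.le hS1 ?_ hS3
    have hk : (S.card : ℝ) ^ 2 ≤ (3 * OPTIR W) ^ 2 := by gcongr
    rw [hT4]
    have h3 : (0 : ℝ) < 2 ^ 28 * (Fintype.card V : ℝ) ^ 3 := by positivity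
    nlinarith [mul_le_mul_of_nonneg_left hk h3.le, mul_pos h3 (pow_pos hx0 2)]
end

section
/- There exist a constant c > 0 and an integer k₀ such that for every k ≥ k₀, on the graph G_k (which has n = k³ + 2 vertices, all edge weights equal to 1/2, and OPT^IR ≤ 2), every persuasive identity-independent signaling scheme with any finite signal space Σ ⊆ [0,1] has cost at least c · k² = c · Θ(n^{2/3}). -/
open Finset

variable {V : Type*}

/-- The instance `G_k`: two centers (`Sum.inl`) and `k²` disjoint cliques of size `k`
(`Sum.inr (i, j)` is the `j`-th vertex of the `i`-th clique); all edges have weight `1/2`,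
and each center is adjacent to every other vertex. -/
noncomputable def Gk (k : ℕ) :
    (Fin 2 ⊕ Fin (k ^ 2) × Fin k) → (Fin 2 ⊕ Fin (k ^ 2) × Fin k) → ℝ
  | Sum.inl i, Sum.inl j => if i = j then 1 else 1 / 2
  | Sum.inl _, Sum.inr _ => 1 / 2
  | Sum.inr _, Sum.inl _ => 1 / 2
  | Sum.inr a, Sum.inr b => if a = b then 1 else if a.1 = b.1 then 1 / 2 else 0

/-- Increasing weight on signals, growing like `θ / (1 - θ)` and truncated near `θ = 1`. -/
noncomputable def dualWeight (k : ℕ) (θ : ℝ) : ℝ :=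
  θ / (2 * max (1 - θ) (1 / (k : ℝ)))

lemma half_le_dualWeight {k : ℕ} (hk : 1 ≤ k) {θ : ℝ} (h0 : 0 ≤ θ) :
    θ / 2 ≤ dualWeight k θ := by
  have hk' : (1 : ℝ) ≤ k := by exact_mod_cast hk
  have hpos : 0 < 1 / (k : ℝ) := by positivity
  have h1 : max (1 - θ) (1 / (k : ℝ)) ≤ 1 :=
    max_le (by linarith) (by rw [div_le_one (by linarith)]; exact hk')
  have h2 : 0 < max (1 - θ) (1 / (k : ℝ)) := lt_max_of_lt_right hpos
  unfold dualWeight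
  gcongr
  linarith

lemma dualWeight_mul_le {k : ℕ} (hk : 1 ≤ k) {θ : ℝ} (h0 : 0 ≤ θ) :
    dualWeight k θ * (1 - θ) ≤ θ / 2 := by
  have hk' : (1 : ℝ) ≤ k := by exact_mod_cast hk
  have hpos : 0 < 1 / (k : ℝ) := by positivity
  have h2 : 0 < max (1 - θ) (1 / (k : ℝ)) := lt_max_of_lt_right hpos
  have h3 : 1 - θ ≤ max (1 - θ) (1 / (k : ℝ)) := le_max_left _ _
  unfold dualWeight
  rw [div_mul_eq_mul_div, div_le_div_iff₀ (by positivity) (by norm_num)]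
  nlinarith

lemma dualWeight_of_near_one {k : ℕ} (hk : 1 ≤ k) {θ : ℝ} (h : (1 - θ) * k ≤ 1) :
    dualWeight k θ = k * θ / 2 := by
  have hk' : (1 : ℝ) ≤ k := by exact_mod_cast hk
  have : 1 - θ ≤ 1 / (k : ℝ) := by rw [le_div_iff₀ (by linarith)]; exact h
  unfold dualWeight
  rw [max_eq_right this]
  field_simp

/-- The weighted slack of a clique, together with its share of the weighted slack
of the centers, is bounded by its load; it is very negative when the load is small. -/
lemma clique_weighted_slack_le {k : ℕ} (g : ℝ → ℝ)
    (hg : ∀ θ, 0 ≤ θ → θ ≤ 1 → θ / 2 ≤ g θ) (hg' : ∀ θ, 0 ≤ θ → θ ≤ 1 → g θ * (1 - θ) ≤ θ / 2)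
    (s : Fin k → ℝ) (h0 : ∀ j, 0 ≤ s j) (h1 : ∀ j, s j ≤ 1) (a x : ℝ) (ha0 : 0 ≤ a) (ha1 : a ≤ 1)
    (hx : ∑ j, s j = 2 * x) :
    ∑ j, (1 - k * g (s j)) * (a + x + s j / 2 - 1) - k * (a * x) ≤ x ∧
    (x ≤ 1 / 4 →
      ∑ j, (1 - k * g (s j)) * (a + x + s j / 2 - 1) - k * (a * x) ≤ x - k * ((1 - a) / 2)) := by
  have hk : (0 : ℝ) ≤ k := Nat.cast_nonneg k
  have hx0 : 0 ≤ x := by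
    have := Finset.sum_nonneg fun j (_ : j ∈ Finset.univ) => h0 j
    linarith
  have hsx : ∀ j, s j / 2 ≤ x := fun j => by
    have := Finset.single_le_sum (fun j _ => h0 j) (Finset.mem_univ j)
    linarith
  set S := ∑ j, g (s j) * ((1 - a - x) - s j / 2) with hS
  have expand : ∑ j, (1 - k * g (s j)) * (a + x + s j / 2 - 1)
      = k * (a + x - 1) + x + k * S := by
    have : ∀ j, (1 - k * g (s j)) * (a + x + s j / 2 - 1)
        = (a + x - 1) + s j / 2 + k * (g (s j) * ((1 - a - x) - s j / 2)) := fun j => by ring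
    simp only [this, Finset.sum_add_distrib, ← Finset.mul_sum, ← Finset.sum_div, hx, ← hS]
    simp
    ring
  rw [expand]
  suffices h : (a + x - 1) + S - a * x ≤ 0 ∧
      (x ≤ 1 / 4 → (a + x - 1) + S - a * x ≤ -((1 - a) / 2)) by
    refine ⟨?_, fun hx4 => ?_⟩
    · nlinarith [mul_le_mul_of_nonneg_left h.1 hk]
    · nlinarith [mul_le_mul_of_nonneg_left (h.2 hx4) hk]
  rcases le_or_gt (1 - a - x) 0 with hr | hr
  · have hSle : S ≤ (1 - a - x) * x := by
      calc S ≤ ∑ j, (1 - a - x) * (s j / 2) := by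
            refine Finset.sum_le_sum fun j _ => ?_
            have := hg _ (h0 j) (h1 j)
            have := h0 j
            nlinarith [mul_nonneg this this]
        _ = (1 - a - x) * x := by
            rw [← Finset.mul_sum, ← Finset.sum_div, hx]; ring
    refine ⟨?_, fun hx4 => ?_⟩
    · nlinarith [sq_nonneg (x - (1 - a)), mul_nonneg ha0 (sub_nonneg.2 ha1)]
    · nlinarith [mul_nonneg (sub_nonneg.2 hx4) (sub_nonneg.2 ha1), sq_nonneg x]
  · have key : ∀ y, 0 ≤ y → (∀ j, s j / 2 < 1 - a - x → y ≤ 1 - s j / 2) →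
        y * S ≤ (1 - a - x) * x := by
      intro y hy0 hy
      calc y * S = ∑ j, y * (g (s j) * ((1 - a - x) - s j / 2)) := by rw [hS, Finset.mul_sum]
        _ ≤ ∑ j, (1 - a - x) * (s j / 2) := by
            refine Finset.sum_le_sum fun j _ => ?_
            have hgj := hg _ (h0 j) (h1 j)
            have hgj' := hg' _ (h0 j) (h1 j)
            have hs0 := h0 j
            have hsxj := hsx j
            have hg0 : 0 ≤ g (s j) := by linarith
            rcases lt_or_ge (s j / 2) (1 - a - x) with hlt | hge
            · have hyj := hy j hlt
              have e1 : y * (g (s j) * ((1 - a - x) - s j / 2))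
                  ≤ (1 - s j / 2) * (g (s j) * ((1 - a - x) - s j / 2)) :=
                mul_le_mul_of_nonneg_right hyj (mul_nonneg hg0 (by linarith))
              have e2 : ((1 - a - x) - s j / 2) * (1 - s j / 2) ≤ (1 - a - x) * (1 - s j) := by
                nlinarith [mul_nonneg hs0 (show 0 ≤ 1 - s j / 2 - (1 - a - x) by linarith)]
              have e3 := mul_le_mul_of_nonneg_left e2 hg0
              have e4 := mul_le_mul_of_nonneg_left hgj' hr.le
              nlinarith
            · have e1 : 0 ≤ y * (g (s j) * (s j / 2 - (1 - a - x))) :=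
                mul_nonneg hy0 (mul_nonneg hg0 (by linarith))
              have e2 : 0 ≤ (1 - a - x) * (s j / 2) := mul_nonneg hr.le (by linarith)
              nlinarith
        _ = (1 - a - x) * x := by
            rw [← Finset.mul_sum, ← Finset.sum_div, hx]; ring
    have k1 := key x hx0 (fun j hj => by linarith)
    have k2 := key (1 - x) (by linarith) (fun j _ => by linarith [hsx j])
    have hax : 0 ≤ a * x := mul_nonneg ha0 hx0
    refine ⟨?_, fun hx4 => ?_⟩
    · have : S ≤ 1 - a - x := by
        rcases hx0.eq_or_lt with h | h
        · rw [← h] at k2 ⊢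
          linarith
        · exact le_of_mul_le_mul_left (by linarith) h
      linarith
    · have hS3 : S ≤ (1 - a - x) / 3 := by
        by_contra! hc
        nlinarith [mul_nonneg hr.le (sub_nonneg.2 hx4),
          mul_nonneg (show 0 ≤ S by linarith) (sub_nonneg.2 hx4)]
      nlinarith [mul_nonneg (sub_nonneg.2 hx4) (sub_nonneg.2 ha1)]

lemma sum_Gk_center_zero (k : ℕ) (s : Fin 2 ⊕ Fin (k ^ 2) × Fin k → ℝ) :
    ∑ u, Gk k (Sum.inl 0) u * s u
      = s (Sum.inl 0) + s (Sum.inl 1) / 2 + (∑ i, ∑ j, s (Sum.inr (i, j))) / 2 := by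
  simp only [Fintype.sum_sum_type, Fin.sum_univ_two, Fintype.sum_prod_type, Gk, ← Finset.mul_sum]
  simp
  ring

lemma sum_Gk_center_one (k : ℕ) (s : Fin 2 ⊕ Fin (k ^ 2) × Fin k → ℝ) :
    ∑ u, Gk k (Sum.inl 1) u * s u
      = s (Sum.inl 1) + s (Sum.inl 0) / 2 + (∑ i, ∑ j, s (Sum.inr (i, j))) / 2 := by
  simp only [Fintype.sum_sum_type, Fin.sum_univ_two, Fintype.sum_prod_type, Gk, ← Finset.mul_sum]
  simp
  ring

lemma sum_Gk_leaf (k : ℕ) (s : Fin 2 ⊕ Fin (k ^ 2) × Fin k → ℝ) (i : Fin (k ^ 2)) (j : Fin k) :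
    ∑ u, Gk k (Sum.inr (i, j)) u * s u
      = (s (Sum.inl 0) + s (Sum.inl 1)) / 2 + (∑ j', s (Sum.inr (i, j'))) / 2
        + s (Sum.inr (i, j)) / 2 := by
  have entry : ∀ i' j', Gk k (Sum.inr (i, j)) (Sum.inr (i', j')) * s (Sum.inr (i', j'))
      = (if i = i' then s (Sum.inr (i', j')) / 2 else 0)
        + (if i = i' then if j = j' then s (Sum.inr (i', j')) / 2 else 0 else 0) := by
    intro i' j'
    by_cases hi : i = i' <;> by_cases hj : j = j' <;> simp [Gk, hi, hj]
    ring
  simp only [Fintype.sum_sum_type, Fin.sum_univ_two, Fintype.sum_prod_type, entry,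
    Finset.sum_add_distrib]
  have h1 : ∑ i', ∑ j', (if i = i' then s (Sum.inr (i', j')) / 2 else 0)
      = (∑ j', s (Sum.inr (i, j'))) / 2 := by
    rw [Finset.sum_comm]
    simp [Finset.sum_div]
  have h2 : ∑ i', ∑ j', (if i = i' then if j = j' then s (Sum.inr (i', j')) / 2 else 0 else 0)
      = s (Sum.inr (i, j)) / 2 := by
    rw [Finset.sum_comm]
    simp
  rw [h1, h2]
  simp only [Gk]
  ring

lemma sum_erase_Gk (k : ℕ) (s : Fin 2 ⊕ Fin (k ^ 2) × Fin k → ℝ)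
    (v : Fin 2 ⊕ Fin (k ^ 2) × Fin k) :
    ∑ u ∈ Finset.univ.erase v, Gk k v u * s u = ∑ u, Gk k v u * s u - s v := by
  rw [Finset.sum_erase_eq_sub (Finset.mem_univ v)]
  rcases v with v | v <;> simp [Gk]

/-- The two centers contribute `O(k)` to the weighted slack besides the part carried by
the leaves, and `-Ω(k²)` when both have signals close to one. -/
lemma center_weighted_slack_le {k : ℕ} (hk : 1 ≤ k) {b c : ℝ} (hb0 : 0 ≤ b) (hb1 : b ≤ 1)
    (hc0 : 0 ≤ c) (hc1 : c ≤ 1) {X : ℝ} (hX : 0 ≤ X) :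
    (1 - k * dualWeight k b) * (b + c / 2 + X / 2 - 1) ≤
        1 / 2 + X / 2 + k * (b / 2) - k * (b / 2 * (X / 2)) ∧
    ((1 - b) * k ≤ 1 / 8 → (1 - c) * k ≤ 1 / 8 →
      (1 - k * dualWeight k b) * (b + c / 2 + X / 2 - 1) ≤
        1 / 2 + X / 2 - (k : ℝ) ^ 2 / 16 - k * (b / 2 * (X / 2))) := by
  have hk' : (1 : ℝ) ≤ k := by exact_mod_cast hk
  have l1 := half_le_dualWeight hk hb0
  have l2 := dualWeight_mul_le hk hb0
  have hd0 : 0 ≤ dualWeight k b := by linarith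
  have e1 : b / 2 * (X / 2) ≤ dualWeight k b * (X / 2) :=
    mul_le_mul_of_nonneg_right l1 (by linarith)
  refine ⟨?_, fun hb hc => ?_⟩
  · have e2 : b / 2 * (X / 2) - b / 2 ≤ dualWeight k b * (b + c / 2 + X / 2 - 1) := by
      nlinarith [mul_nonneg hd0 hc0]
    nlinarith [mul_le_mul_of_nonneg_left e2 (by linarith : (0 : ℝ) ≤ k)]
  · have hb' : 7 / 8 ≤ b := by nlinarith
    have hc' : 7 / 8 ≤ c := by nlinarith
    have e2 : (k : ℝ) / 16 ≤ dualWeight k b * (b + c / 2 - 1) := by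
      rw [dualWeight_of_near_one hk (by linarith)]
      have : (1 : ℝ) / 16 ≤ b / 2 * (b + c / 2 - 1) := by nlinarith
      nlinarith
    have e3 : b / 2 * (X / 2) + k / 16 ≤ dualWeight k b * (b + c / 2 + X / 2 - 1) := by
      nlinarith
    nlinarith [mul_le_mul_of_nonneg_left e3 (by linarith : (0 : ℝ) ≤ k)]

/-- Pointwise dual inequality: the weighted slack of any signal assignment is bounded by
a multiple of its total signal minus `Ω(k²)`. -/
lemma weighted_slack_le {k : ℕ} (hk : 100 ≤ k) (s : Fin 2 ⊕ Fin (k ^ 2) × Fin k → ℝ)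
    (h0 : ∀ v, 0 ≤ s v) (h1 : ∀ v, s v ≤ 1) :
    ∑ v, (1 - k * dualWeight k (s v)) *
        (∑ u ∈ Finset.univ.erase v, Gk k v u * s u - (1 - s v))
      ≤ 10 * ∑ v, s v - (k : ℝ) ^ 2 / 64 := by
  have hk1 : 1 ≤ k := by omega
  have hk' : (100 : ℝ) ≤ k := by exact_mod_cast hk
  obtain ⟨b, hb⟩ : ∃ b, b = s (Sum.inl 0) := ⟨_, rfl⟩
  obtain ⟨c, hc⟩ : ∃ c, c = s (Sum.inl 1) := ⟨_, rfl⟩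
  have hb0 : 0 ≤ b := hb ▸ h0 _
  have hb1 : b ≤ 1 := hb ▸ h1 _
  have hc0 : 0 ≤ c := hc ▸ h0 _
  have hc1 : c ≤ 1 := hc ▸ h1 _
  set x : Fin (k ^ 2) → ℝ := fun i => (∑ j, s (Sum.inr (i, j))) / 2 with hx
  have hxi : ∀ i, ∑ j, s (Sum.inr (i, j)) = 2 * x i := fun i => by simp only [hx]; ring
  have hx0 : ∀ i, 0 ≤ x i := fun i =>
    div_nonneg (Finset.sum_nonneg fun j _ => h0 _) (by norm_num)
  set Y := ∑ i, x i with hY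
  have hY0 : 0 ≤ Y := Finset.sum_nonneg fun i _ => hx0 i
  have hXY : ∑ i, ∑ j, s (Sum.inr (i, j)) = 2 * Y := by
    simp_rw [hxi, ← Finset.mul_sum]; rfl
  have hcl := fun i => clique_weighted_slack_le (k := k) (dualWeight k)
    (fun θ h _ => half_le_dualWeight hk1 h) (fun θ h _ => dualWeight_mul_le hk1 h)
    (fun j => s (Sum.inr (i, j))) (fun j => h0 _) (fun j => h1 _) ((b + c) / 2) (x i)
    (by linarith) (by linarith) (hxi i)
  set F : Fin (k ^ 2) → ℝ := fun i => ∑ j, (1 - k * dualWeight k (s (Sum.inr (i, j)))) *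
    ((b + c) / 2 + x i + s (Sum.inr (i, j)) / 2 - 1) - k * ((b + c) / 2 * x i) with hF
  have hFsum : ∑ i, ∑ j, (1 - k * dualWeight k (s (Sum.inr (i, j)))) *
      ((b + c) / 2 + x i + s (Sum.inr (i, j)) / 2 - 1)
        = ∑ i, F i + k * ((b + c) / 2 * Y) := by
    simp only [hF, Finset.sum_sub_distrib, ← Finset.mul_sum, hY]
    ring
  have hb' := center_weighted_slack_le hk1 hb0 hb1 hc0 hc1 (X := 2 * Y) (by linarith)
  have hc' := center_weighted_slack_le hk1 hc0 hc1 hb0 hb1 (X := 2 * Y) (by linarith)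
  have hL : ∑ v, (1 - k * dualWeight k (s v)) *
        (∑ u ∈ Finset.univ.erase v, Gk k v u * s u - (1 - s v))
      = (1 - k * dualWeight k b) * (b + c / 2 + 2 * Y / 2 - 1)
        + (1 - k * dualWeight k c) * (c + b / 2 + 2 * Y / 2 - 1)
        + (∑ i, F i + k * ((b + c) / 2 * Y)) := by
    rw [← hFsum]
    simp only [sum_erase_Gk]
    rw [Fintype.sum_sum_type, Fin.sum_univ_two, Fintype.sum_prod_type]
    simp only [sum_Gk_center_zero, sum_Gk_center_one, sum_Gk_leaf, hxi, ← Finset.mul_sum, ← hY, ← hb, ← hc]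
    congr 1
    · ring
    · refine Finset.sum_congr rfl fun i _ => Finset.sum_congr rfl fun j _ => ?_
      ring
  have hR : ∑ v, s v = b + c + 2 * Y := by
    simp only [Fintype.sum_sum_type, Fin.sum_univ_two, Fintype.sum_prod_type, hXY, ← hb, ← hc]
  rw [hL, hR]
  by_cases hnear : (1 - b) * k ≤ 1 / 8 ∧ (1 - c) * k ≤ 1 / 8
  · have e1 := hb'.2 hnear.1 hnear.2
    have e2 := hc'.2 hnear.2 hnear.1
    have e3 : ∑ i, F i ≤ Y := Finset.sum_le_sum fun i _ => (hcl i).1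
    nlinarith
  · have hfar : (1 : ℝ) / 16 ≤ k * (1 - (b + c) / 2) := by
      by_contra! hcon
      refine hnear ⟨?_, ?_⟩ <;> nlinarith
    have e3 : ∑ i, F i ≤ ∑ i, (2 * x i - 1 / 32) := by
      refine Finset.sum_le_sum fun i _ => ?_
      rcases le_or_gt (x i) (1 / 4) with hle | hgt
      · have := (hcl i).2 hle
        have := hx0 i
        simp only [hF]
        linarith
      · have := (hcl i).1
        simp only [hF]
        linarith
    have e4 : ∑ i, (2 * x i - 1 / 32) = 2 * Y - (k : ℝ) ^ 2 / 32 := by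
      rw [Finset.sum_sub_distrib, ← Finset.mul_sum, ← hY]
      simp
      ring
    have e1 := hb'.1
    have e2 := hc'.1
    nlinarith

/-- Any weighting of the slacks regroups into a vertexwise expectation. -/
lemma Scheme.sum_mul_slack {V : Type*} [Fintype V] [DecidableEq V] (D : Scheme V)
    (W : V → V → ℝ) (w : ℝ → ℝ) :
    ∑ θ ∈ D.sig, w θ * D.slack W θ = D.exp (fun s => ∑ v, w (s v) *
      (∑ u ∈ Finset.univ.erase v, W v u * s u - (1 - s v))) := by
  have hslack : ∀ θ, w θ * D.slack W θ = ∑ s ∈ D.supp, D.p s * ∑ v, if s v = θ then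
      w (s v) * (∑ u ∈ Finset.univ.erase v, W v u * s u - (1 - s v)) else 0 := by
    intro θ
    simp only [Scheme.slack, Scheme.Contrib, Scheme.Num, Scheme.exp]
    rw [Finset.mul_sum, ← Finset.sum_sub_distrib, Finset.mul_sum]
    refine Finset.sum_congr rfl fun s _ => ?_
    have : ∀ p q r t : ℝ, w θ * (p * q - r * (p * t)) = p * (w θ * (q - r * t)) := by
      intros; ring
    rw [this]
    congr 1
    rw [Finset.mul_sum, ← Finset.sum_sub_distrib, Finset.mul_sum]
    refine Finset.sum_congr rfl fun v _ => ?_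
    split_ifs with h
    · rw [h]; ring
    · ring
  simp_rw [hslack]
  rw [Finset.sum_comm]
  refine Finset.sum_congr rfl fun s hs => ?_
  rw [← Finset.mul_sum, Finset.sum_comm]
  congr 1
  refine Finset.sum_congr rfl fun v _ => ?_
  rw [Finset.sum_ite_eq, if_pos (D.val_mem s hs v)]

lemma Scheme.Persuasive.sum_mul_slack_nonneg {V : Type*} [Fintype V] [DecidableEq V]
    {D : Scheme V} {W : V → V → ℝ} (hD : D.Persuasive W) {w : ℝ → ℝ} (hw : 0 ≤ w 0) :
    0 ≤ ∑ θ ∈ D.sig, w θ * D.slack W θ := by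
  refine Finset.sum_nonneg fun θ hθ => ?_
  rcases (D.sig_mem θ hθ).1.eq_or_lt with h | h
  · subst h
    exact mul_nonneg hw (hD.2 hθ)
  · rw [hD.1 θ hθ h, mul_zero]

lemma OPTIR_Gk_le (k : ℕ) : OPTIR (Gk k) ≤ 2 := by
  refine csInf_le ⟨0, ?_⟩ ⟨Sum.elim (fun _ => 1) (fun _ => 0), ⟨?_, ?_⟩, ?_, ?_⟩
  · rintro _ ⟨θ, hθ, -, rfl⟩
    exact Finset.sum_nonneg fun v _ => hθ.1 v
  · rintro (v | v) <;> simp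
  · rintro (v | ⟨i, j⟩)
    · fin_cases v
      · refine le_of_le_of_eq ?_ (sum_Gk_center_zero k _).symm
        norm_num
      · refine le_of_le_of_eq ?_ (sum_Gk_center_one k _).symm
        norm_num
    · rw [sum_Gk_leaf]
      norm_num
  · rintro (v | v) <;> simp
  · simp

/-- There exist `c > 0` and `k₀` such that for every `k ≥ k₀`, on the
graph `G_k` (with `n = k³ + 2` vertices and `OPT^IR ≤ 2`) every persuasive
identity-independent signaling scheme has cost at least `c·k² = c·Θ(n^(2/3))`. -/
theorem statement4 :
    ∃ (c : ℝ) (k₀ : ℕ), 0 < c ∧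
      ∀ k : ℕ, k₀ ≤ k →
        OPTIR (Gk k) ≤ 2 ∧
        ∀ D : Scheme (Fin 2 ⊕ Fin (k ^ 2) × Fin k), D.Persuasive (Gk k) →
          c * (k : ℝ) ^ 2 ≤ D.cost := by
  refine ⟨1 / 640, 100, by norm_num, fun k hk => ⟨OPTIR_Gk_le k, fun D hD => ?_⟩⟩
  have hnonneg := hD.sum_mul_slack_nonneg (w := fun θ => 1 - k * dualWeight k θ)
    (by simp [dualWeight])
  rw [D.sum_mul_slack] at hnonneg
  have hle : D.exp (fun s => ∑ v, (1 - k * dualWeight k (s v)) *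
      (∑ u ∈ Finset.univ.erase v, Gk k v u * s u - (1 - s v)))
      ≤ D.exp (fun s => 10 * ∑ v, s v - (k : ℝ) ^ 2 / 64) :=
    Finset.sum_le_sum fun s hs => mul_le_mul_of_nonneg_left
      (weighted_slack_le hk s (fun v => (D.sig_mem _ (D.val_mem s hs v)).1)
        (fun v => (D.sig_mem _ (D.val_mem s hs v)).2)) (D.p_nonneg s hs)
  have heq : D.exp (fun s => 10 * ∑ v, s v - (k : ℝ) ^ 2 / 64)
      = 10 * D.cost - (k : ℝ) ^ 2 / 64 := by
    simp only [Scheme.cost, Scheme.exp, mul_sub, Finset.sum_sub_distrib, ← Finset.sum_mul,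
      D.p_sum, one_mul, mul_left_comm _ (10 : ℝ), ← Finset.mul_sum]
  linarith
end

section
/- Let G be a unit-weight collaboration instance on n vertices admitting an optimal stable solution, and suppose OPT < OPT^stable. Let PoS = OPT^stable / OPT and set ε = max{ min{1/2, (PoS − 1)/(PoS + 2n/(PoS + 1))}, (PoS − 1)/(PoS + (n − OPT)) } > 0. Then there exists a persuasive binary identity-independent signaling scheme D with Cost(D) ≤ OPT^stable − ε·(OPT^stable − OPT); in particular Cost(D) < OPT^stable. -/
open Finset

variable {V : Type*}

/-- A stable solution: feasible, and each vertex's contribution is the least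
nonnegative amount meeting its own feasibility given the others' contributions. -/
def Stable [Fintype V] [DecidableEq V] (W : V → V → ℝ) (θ : V → ℝ) : Prop :=
  Feasible W θ ∧
  ∀ v : V, IsLeast {x : ℝ | 0 ≤ x ∧ 1 ≤ x + ∑ u ∈ Finset.univ.erase v, W v u * θ u} (θ v)

section Hull

variable [Fintype V]

/-- The `{0,1}`-vectors on `V`. -/
def binaryVectors (V : Type*) : Set (V → ℝ) := {s | ∀ v, s v = 0 ∨ s v = 1}

/-- The indicator vectors of the independent sets of `W`. -/
def indepVectors (W : V → V → ℝ) : Set (V → ℝ) :=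
  {s | s ∈ binaryVectors V ∧ ∀ u v, u ≠ v → W u v * (s u * s v) = 0}

lemma weight_eq_zero_or_one {W : V → V → ℝ} (hW : IsCollab W) (hU : UnitWeight W) (u v : V) :
    W u v = 0 ∨ W u v = 1 := by
  by_cases h : u = v
  · subst h; exact Or.inr (hW.2.2 u)
  · exact hU u v h

variable [DecidableEq V]

/-- Add `v` to a set and delete the other neighbors of `v`, as an affine operation on vectors. -/
def insertVertex (W : V → V → ℝ) (v : V) (s : V → ℝ) : V → ℝ :=
  fun u => if u = v then 1 else (1 - W u v) * s u

lemma insertVertex_mem_indepVectors {W : V → V → ℝ} (hW : IsCollab W) (hU : UnitWeight W) (v : V)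
    {s : V → ℝ} (hs : s ∈ indepVectors W) : insertVertex W v s ∈ indepVectors W := by
  refine ⟨fun u => ?_, fun a b hab => ?_⟩
  · simp only [insertVertex]
    split_ifs
    · exact Or.inr rfl
    · rcases weight_eq_zero_or_one hW hU u v with h | h <;> rcases hs.1 u with h' | h' <;>
        simp [h, h']
  · have key := hs.2 a b hab
    simp only [insertVertex]
    split_ifs with h1 h2 h2
    · exact absurd (h1.trans h2.symm) hab
    · subst h1
      rw [hW.1 a b]
      rcases weight_eq_zero_or_one hW hU b a with h | h <;> simp [h]
    · subst h2
      rcases weight_eq_zero_or_one hW hU a b with h | h <;> simp [h]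
    · linear_combination (1 - W a v) * (1 - W b v) * key

lemma insertVertex_mem_convexHull {W : V → V → ℝ} (hW : IsCollab W) (hU : UnitWeight W) (v : V)
    {s : V → ℝ} (hs : s ∈ convexHull ℝ (indepVectors W)) :
    insertVertex W v s ∈ convexHull ℝ (indepVectors W) := by
  have hconv : Convex ℝ {y : V → ℝ | insertVertex W v y ∈ convexHull ℝ (indepVectors W)} := by
    intro x hx y hy a b ha hb hab
    have h := convex_convexHull ℝ (indepVectors W) hx hy ha hb hab
    have heq : insertVertex W v (a • x + b • y)
        = a • insertVertex W v x + b • insertVertex W v y := by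
      funext u
      simp only [insertVertex, Pi.add_apply, Pi.smul_apply, smul_eq_mul]
      split_ifs
      · linarith
      · ring
    simpa only [Set.mem_ofPred_eq, heq] using h
  refine convexHull_min (fun y hy => ?_) hconv hs
  exact subset_convexHull ℝ (indepVectors W) (insertVertex_mem_indepVectors hW hU v hy)

/-- Drawing the vertices of `A` successively with probabilities proportional to `θ` and keeping
those drawn before all of their neighbors gives a random independent set with the marginals
`θ u / ∑ w ∈ A, W u w * θ w`. -/
lemma ratio_mem_convexHull_indepVectors {W : V → V → ℝ} (hW : IsCollab W) (hU : UnitWeight W)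
    (θ : V → ℝ) (A : Finset V) (hA : ∀ v ∈ A, 0 < θ v) :
    (fun u => if u ∈ A then θ u / ∑ w ∈ A, W u w * θ w else 0) ∈
      convexHull ℝ (indepVectors W) := by
  induction A using Finset.strongInduction with
  | H A ih =>
  rcases A.eq_empty_or_nonempty with rfl | hne
  · refine subset_convexHull ℝ _ ⟨fun v => ?_, fun u v _ => ?_⟩ <;> simp
  have hΘ : 0 < ∑ v ∈ A, θ v := Finset.sum_pos hA hne
  have hmem := (convex_convexHull ℝ (indepVectors W)).sum_mem (t := A)
    (w := fun v => θ v / ∑ v ∈ A, θ v)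
    (z := fun v => insertVertex W v
      (fun u => if u ∈ A.erase v then θ u / ∑ w ∈ A.erase v, W u w * θ w else 0))
    (fun v hv => (div_pos (hA v hv) hΘ).le)
    (by rw [← Finset.sum_div, div_self hΘ.ne'])
    (fun v hv => insertVertex_mem_convexHull hW hU v
      (ih _ (Finset.erase_ssubset hv) fun u hu => hA u (Finset.mem_of_mem_erase hu)))
  convert hmem using 1
  funext u
  simp only [Finset.sum_apply, Pi.smul_apply, smul_eq_mul, insertVertex]
  split_ifs with hu
  · have hR : 0 < ∑ w ∈ A, W u w * θ w :=
      Finset.sum_pos' (fun w hw => mul_nonneg (hW.2.1 u w).1 (hA w hw).le)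
        ⟨u, hu, by rw [hW.2.2, one_mul]; exact hA u hu⟩
    have hterm : ∀ v ∈ A, (θ v / ∑ v ∈ A, θ v) * (if u = v then 1 else (1 - W u v) *
        (if u ∈ A.erase v then θ u / ∑ w ∈ A.erase v, W u w * θ w else 0))
        = (if u = v then θ v / ∑ v ∈ A, θ v else 0) +
          (θ v - W u v * θ v) * (θ u / ((∑ v ∈ A, θ v) * ∑ w ∈ A, W u w * θ w)) := by
      intro v hv
      split_ifs with h1 h2
      · subst h1; rw [hW.2.2]; ring
      · rcases weight_eq_zero_or_one hW hU u v with h | h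
        · have hs : ∑ w ∈ A.erase v, W u w * θ w = ∑ w ∈ A, W u w * θ w := by
            rw [← Finset.add_sum_erase A _ hv, h]; ring
          rw [hs, h]; field_simp; ring
        · rw [h]; ring
      · exact absurd (Finset.mem_erase.2 ⟨h1, hu⟩) h2
    rw [Finset.sum_congr rfl hterm, Finset.sum_add_distrib, ← Finset.sum_mul,
      Finset.sum_sub_distrib, Finset.sum_ite_eq, if_pos hu]
    field_simp
    ring
  · symm
    refine Finset.sum_eq_zero fun v hv => ?_
    have huv : u ≠ v := fun h => hu (h ▸ hv)
    rw [if_neg huv, if_neg (fun h => hu (Finset.mem_of_mem_erase h))]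
    ring

/-- Each supported vertex of a stable solution has coverage exactly one. -/
lemma Stable.coverage_eq_one {W : V → V → ℝ} (hW : IsCollab W) {θ : V → ℝ} (h : Stable W θ)
    {v : V} (hv : 0 < θ v) : ∑ u, W v u * θ u = 1 := by
  refine le_antisymm ?_ (h.1.2 v)
  rw [← Finset.add_sum_erase _ _ (Finset.mem_univ v), hW.2.2, one_mul]
  set r := ∑ u ∈ Finset.univ.erase v, W v u * θ u
  have hle : θ v ≤ max 0 (1 - r) := (h.2 v).2
    ⟨le_max_left _ _, by linarith [le_max_right 0 (1 - r)]⟩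
  rcases le_max_iff.1 hle with h | h <;> linarith

lemma Stable.mem_convexHull_indepVectors {W : V → V → ℝ} (hW : IsCollab W) (hU : UnitWeight W)
    {θ : V → ℝ} (h : Stable W θ) : θ ∈ convexHull ℝ (indepVectors W) := by
  have hmem := ratio_mem_convexHull_indepVectors hW hU θ (Finset.univ.filter fun v => 0 < θ v)
    (by simp)
  convert hmem using 1
  funext u
  by_cases hu : 0 < θ u
  · have hs : ∑ w ∈ Finset.univ.filter (fun v => 0 < θ v), W u w * θ w = 1 := by
      rw [← h.coverage_eq_one hW hu]
      refine Finset.sum_subset (Finset.subset_univ _) fun w _ hw => ?_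
      have : θ w = 0 := le_antisymm (by simpa using hw) (h.1.1 w)
      rw [this, mul_zero]
    rw [if_pos (by simpa using hu), hs, div_one]
  · rw [if_neg (by simpa using hu)]
    exact le_antisymm (not_lt.1 hu) (h.1.1 u)

/-- Total weight, internal edge weight and total coverage of a vector. -/
def stats (W : V → V → ℝ) (s : V → ℝ) : ℝ × ℝ × ℝ :=
  (∑ v, s v, ∑ v, ∑ u ∈ Finset.univ.erase v, W v u * (s v * s u), ∑ v, ∑ u, W v u * s u)

lemma stats_mem_convexHull_of_indep {W : V → V → ℝ} {θ : V → ℝ}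
    (h : θ ∈ convexHull ℝ (indepVectors W)) :
    (∑ v, θ v, (0 : ℝ), ∑ v, ∑ u, W v u * θ u) ∈ convexHull ℝ (stats W '' binaryVectors V) := by
  have hconv : Convex ℝ {y : V → ℝ | (∑ v, y v, (0 : ℝ), ∑ v, ∑ u, W v u * y u) ∈
      convexHull ℝ (stats W '' binaryVectors V)} := by
    intro x hx y hy a b ha hb hab
    have h := convex_convexHull ℝ (stats W '' binaryVectors V) hx hy ha hb hab
    simp only [Set.mem_ofPred_eq]
    convert h using 1
    simp only [Prod.smul_mk, Prod.mk_add_mk, smul_eq_mul, Finset.mul_sum, Pi.add_apply,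
      Pi.smul_apply, ← Finset.sum_add_distrib, Prod.mk.injEq, mul_zero, add_zero, true_and]
    refine Finset.sum_congr rfl fun v _ => Finset.sum_congr rfl fun u _ => by ring
  refine convexHull_min (fun s hs => ?_) hconv h
  refine subset_convexHull ℝ (stats W '' binaryVectors V) ⟨s, hs.1, ?_⟩
  simp only [stats, Prod.mk.injEq, true_and, and_true]
  exact Finset.sum_eq_zero fun v _ => Finset.sum_eq_zero fun u hu =>
    hs.2 v u (Finset.ne_of_mem_erase hu).symm

lemma stats_update {W : V → V → ℝ} (θ : V → ℝ) (w : V) :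
    stats W θ = θ w • stats W (Function.update θ w 1) +
      (1 - θ w) • stats W (Function.update θ w 0) := by
  simp only [stats, Prod.smul_mk, Prod.mk_add_mk, smul_eq_mul, Finset.mul_sum,
    ← Finset.sum_add_distrib, Prod.mk.injEq]
  refine ⟨Finset.sum_congr rfl fun v _ => ?_,
    Finset.sum_congr rfl fun v _ => Finset.sum_congr rfl fun u hu => ?_,
    Finset.sum_congr rfl fun v _ => Finset.sum_congr rfl fun u _ => ?_⟩
  · by_cases h : v = w
    · subst h; simp
    · simp only [Function.update_of_ne h]; ring
  · have huv := Finset.ne_of_mem_erase hu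
    by_cases h : v = w
    · subst h; simp only [Function.update_self, Function.update_of_ne huv]; ring
    · by_cases h' : u = w
      · subst h'; simp only [Function.update_self, Function.update_of_ne h]; ring
      · simp only [Function.update_of_ne h, Function.update_of_ne h']; ring
  · by_cases h : u = w
    · subst h; simp only [Function.update_self]; ring
    · simp only [Function.update_of_ne h]; ring

/-- Independent rounding of a vector with entries in `[0,1]` preserves its statistics. -/
lemma stats_mem_convexHull (W : V → V → ℝ) (θ : V → ℝ) (hθ : ∀ v, 0 ≤ θ v ∧ θ v ≤ 1) :
    stats W θ ∈ convexHull ℝ (stats W '' binaryVectors V) := by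
  suffices H : ∀ (A : Finset V) (θ : V → ℝ), (∀ v, 0 ≤ θ v ∧ θ v ≤ 1) →
      (∀ v ∉ A, θ v = 0 ∨ θ v = 1) →
      stats W θ ∈ convexHull ℝ (stats W '' binaryVectors V) from
    H Finset.univ θ hθ (by simp)
  intro A
  induction A using Finset.induction_on with
  | empty =>
    intro θ _ h
    exact subset_convexHull ℝ _ ⟨θ, fun v => h v (Finset.notMem_empty v), rfl⟩
  | insert w A _ ih =>
    intro θ hθ h
    have aux : ∀ x : ℝ, x = 0 ∨ x = 1 → stats W (Function.update θ w x) ∈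
        convexHull ℝ (stats W '' binaryVectors V) := by
      intro x hx
      refine ih _ (fun v => ?_) (fun v hv => ?_)
      · by_cases hvw : v = w
        · subst hvw; rcases hx with rfl | rfl <;> simp
        · rw [Function.update_of_ne hvw]; exact hθ v
      · by_cases hvw : v = w
        · subst hvw; simpa using hx
        · rw [Function.update_of_ne hvw]; exact h v (by simp [hvw, hv])
    rw [stats_update θ w]
    exact convex_convexHull ℝ _ (aux 1 (Or.inr rfl)) (aux 0 (Or.inl rfl)) (hθ w).1
      (by linarith [(hθ w).2]) (by ring)

end Hull

section SchemeConstruction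

variable [Fintype V] [DecidableEq V]

/-- A point in the convex hull of the statistics of vertex sets, together with a scaling `x`
satisfying the two slack conditions, yields a persuasive scheme with signals `0` and `x`. -/
lemma exists_persuasive_of_mem_convexHull {W : V → V → ℝ} (hW : IsCollab W) {c e d x : ℝ}
    (hx0 : 0 < x) (hx1 : x ≤ 1)
    (h : (c, e, d) ∈ convexHull ℝ (stats W '' binaryVectors V))
    (he : x * e = (1 - x) * c) (hd : (Fintype.card V : ℝ) ≤ x * d) :
    ∃ D : Scheme V, D.sig.card ≤ 2 ∧ D.Persuasive W ∧ D.cost = x * c := by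
  have hfin : (stats W '' binaryVectors V).Finite := by
    refine Set.Finite.image _ ((Set.Finite.pi' fun _ : V => Set.toFinite ({0, 1} : Set ℝ)).subset ?_)
    exact fun s hs v => hs v
  rw [hfin.convexHull_eq] at h
  obtain ⟨w, hw0, hw1, hw⟩ := h
  have hex : ∀ y : ℝ × ℝ × ℝ, ∃ s : V → ℝ,
      y ∈ stats W '' binaryVectors V → s ∈ binaryVectors V ∧ stats W s = y := by
    intro y
    by_cases hy : y ∈ stats W '' binaryVectors V
    · obtain ⟨s, hs⟩ := hy
      exact ⟨s, fun _ => hs⟩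
    · exact ⟨0, fun h => absurd h hy⟩
  choose g hg using hex
  set F := hfin.toFinset
  replace hg : ∀ y ∈ F, g y ∈ binaryVectors V ∧ stats W (g y) = y :=
    fun y hy => hg y (hfin.mem_toFinset.1 hy)
  have hstats : ∀ y ∈ F, stats W (x⁻¹ • x • g y) = y := fun y hy => by
    rw [smul_smul, inv_mul_cancel₀ hx0.ne', one_smul, (hg y hy).2]
  have hinj : Set.InjOn (fun y => x • g y) (F : Set (ℝ × ℝ × ℝ)) := fun y hy z hz hyz => by
    rw [← hstats y hy, ← hstats z hz]
    exact congrArg (fun s => stats W (x⁻¹ • s)) hyz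
  have hsum : ∀ f : (V → ℝ) → ℝ, ∑ s ∈ F.image (fun y => x • g y), w (stats W (x⁻¹ • s)) * f s
      = ∑ y ∈ F, w y * f (x • g y) := by
    intro f
    rw [Finset.sum_image hinj]
    exact Finset.sum_congr rfl fun y hy => by rw [hstats y hy]
  rw [Finset.centerMass_eq_of_sum_1 _ _ hw1] at hw
  have hc : ∑ y ∈ F, w y * y.1 = c := by
    simpa [Prod.fst_sum] using congrArg Prod.fst hw
  have he' : ∑ y ∈ F, w y * y.2.1 = e := by
    simpa [Prod.fst_sum, Prod.snd_sum] using congrArg (fun z => z.2.1) hw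
  have hd' : ∑ y ∈ F, w y * y.2.2 = d := by
    simpa [Prod.fst_sum, Prod.snd_sum] using congrArg (fun z => z.2.2) hw
  let D : Scheme V :=
    { sig := {0, x}
      sig_mem := by
        intro θ hθ
        rcases Finset.mem_insert.1 hθ with rfl | hθ
        · exact ⟨le_rfl, zero_le_one⟩
        · rw [Finset.mem_singleton.1 hθ]; exact ⟨hx0.le, hx1⟩
      supp := F.image fun y => x • g y
      val_mem := by
        intro s hs v
        obtain ⟨y, hy, rfl⟩ := Finset.mem_image.1 hs
        rcases (hg y hy).1 v with h | h <;> simp [h]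
      p := fun s => w (stats W (x⁻¹ • s))
      p_nonneg := by
        intro s hs
        obtain ⟨y, hy, rfl⟩ := Finset.mem_image.1 hs
        simp only [hstats y hy]
        exact hw0 y (hfin.mem_toFinset.1 hy)
      p_sum := by simpa [hw1] using hsum fun _ => 1 }
  have hexp : ∀ f, D.exp f = ∑ y ∈ F, w y * f (x • g y) := hsum
  have hslackx : D.slack W x = 0 := by
    rw [Scheme.slack, Scheme.Contrib, Scheme.Num, hexp, hexp]
    have hC : ∀ y ∈ F, (∑ v, if (x • g y) v = x then
        ∑ u ∈ Finset.univ.erase v, W v u * (x • g y) u else 0) = x * y.2.1 := by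
      intro y hy
      rw [← congrArg (fun z => z.2.1) (hg y hy).2]
      simp only [stats, Finset.mul_sum]
      refine Finset.sum_congr rfl fun v _ => ?_
      rcases (hg y hy).1 v with h | h
      · simp [h, hx0.ne]
      · simp only [Pi.smul_apply, smul_eq_mul, h, mul_one, if_true]
        exact Finset.sum_congr rfl fun u _ => by ring
    have hN : ∀ y ∈ F, (∑ v, if (x • g y) v = x then (1 : ℝ) else 0) = y.1 := by
      intro y hy
      rw [← congrArg Prod.fst (hg y hy).2]
      refine Finset.sum_congr rfl fun v _ => ?_
      rcases (hg y hy).1 v with h | h <;> simp [h, hx0.ne]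
    have h1 := Finset.sum_congr rfl fun y hy => congrArg (w y * ·) (hC y hy)
    have h2 := Finset.sum_congr rfl fun y hy => congrArg (w y * ·) (hN y hy)
    simp only [mul_left_comm _ x, ← Finset.mul_sum] at h1
    rw [h1, h2, hc, he', he, sub_self]
  have hslack0 : D.slack W 0 = x * d - Fintype.card V := by
    rw [Scheme.slack, Scheme.Contrib, Scheme.Num, hexp, hexp]
    have hC : ∀ y ∈ F, (∑ v, if (x • g y) v = 0 then
        ∑ u ∈ Finset.univ.erase v, W v u * (x • g y) u else 0) =
          x * (y.2.2 - y.1 - y.2.1) := by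
      intro y hy
      conv_rhs => rw [← (hg y hy).2]
      simp only [stats, ← Finset.sum_sub_distrib, Finset.mul_sum]
      refine Finset.sum_congr rfl fun v _ => ?_
      rw [← Finset.add_sum_erase _ _ (Finset.mem_univ v), hW.2.2]
      rcases (hg y hy).1 v with h | h
      · simp only [Pi.smul_apply, smul_eq_mul, h, mul_zero, zero_mul, if_true, zero_add, sub_zero,
          Finset.sum_const_zero, Finset.mul_sum]
        exact Finset.sum_congr rfl fun u _ => by ring
      · simp [h, hx0.ne']
    have hN : ∀ y ∈ F, (∑ v, if (x • g y) v = 0 then (1 : ℝ) else 0) = Fintype.card V - y.1 := by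
      intro y hy
      rw [← congrArg Prod.fst (hg y hy).2, Fintype.card_eq_sum_ones]
      simp only [stats]
      push_cast
      rw [← Finset.sum_sub_distrib]
      refine Finset.sum_congr rfl fun v _ => ?_
      rcases (hg y hy).1 v with h | h <;> simp [h, hx0.ne']
    rw [Finset.sum_congr rfl fun y hy => congrArg (w y * ·) (hC y hy),
      Finset.sum_congr rfl fun y hy => congrArg (w y * ·) (hN y hy)]
    have h1 : ∑ y ∈ F, w y * (x * (y.2.2 - y.1 - y.2.1)) = x * (d - c - e) := by
      rw [← hc, ← he', ← hd', ← Finset.sum_sub_distrib, ← Finset.sum_sub_distrib, Finset.mul_sum]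
      exact Finset.sum_congr rfl fun y _ => by ring
    have h2 : ∑ y ∈ F, w y * (Fintype.card V - y.1) = Fintype.card V - c := by
      simp only [mul_sub, Finset.sum_sub_distrib, ← Finset.sum_mul, hw1, hc, one_mul]
    rw [h1, h2]
    linear_combination -he
  refine ⟨D, Finset.card_le_two, ⟨fun θ hθ hpos => ?_, fun _ => ?_⟩, ?_⟩
  · rcases Finset.mem_insert.1 hθ with rfl | hθ
    · exact absurd hpos (lt_irrefl _)
    · rw [Finset.mem_singleton.1 hθ]; exact hslackx
  · rw [hslack0]; linarith
  · rw [Scheme.cost, hexp, ← hc, Finset.mul_sum]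
    refine Finset.sum_congr rfl fun y hy => ?_
    have hy1 : ∑ v, g y v = y.1 := congrArg Prod.fst (hg y hy).2
    simp only [Pi.smul_apply, smul_eq_mul, ← Finset.mul_sum, hy1]
    ring

end SchemeConstruction

section Optimum

variable [Fintype V]

lemma exists_optimal {W : V → V → ℝ} (hW : IsCollab W) (hU : UnitWeight W) :
    ∃ θ : V → ℝ, Feasible W θ ∧ (∀ v, θ v ≤ 1) ∧ ∑ v, θ v = OPT W := by
  have hcompact : IsCompact {θ : V → ℝ | Feasible W θ ∧ ∀ v, θ v ≤ 1} := by
    refine (isCompact_Icc (a := (0 : V → ℝ)) (b := 1)).of_isClosed_subset ?_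
      fun θ h => ⟨fun v => h.1.1 v, fun v => h.2 v⟩
    simp only [Feasible, Set.ofPred_and, Set.ofPred_forall]
    refine ((isClosed_iInter fun v => ?_).inter (isClosed_iInter fun v => ?_)).inter
      (isClosed_iInter fun v => ?_)
    · exact isClosed_le (by fun_prop) (by fun_prop)
    · exact isClosed_le (by fun_prop) (by fun_prop)
    · exact isClosed_le (by fun_prop) (by fun_prop)
  have hne : {θ : V → ℝ | Feasible W θ ∧ ∀ v, θ v ≤ 1}.Nonempty := by
    refine ⟨fun _ => 1, ⟨fun _ => zero_le_one, fun v => ?_⟩, fun _ => le_rfl⟩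
    have := Finset.single_le_sum (f := fun u => W v u * 1)
      (fun u _ => by simpa using (hW.2.1 v u).1) (Finset.mem_univ v)
    simpa [hW.2.2] using this
  obtain ⟨θ, ⟨hf, h1⟩, hmin⟩ := hcompact.exists_isMinOn hne
    (f := fun θ => ∑ v, θ v) (by fun_prop)
  refine ⟨θ, hf, h1, (IsLeast.csInf_eq (a := ∑ v, θ v) ⟨?_, ?_⟩).symm⟩
  · exact ⟨θ, hf, rfl⟩
  rintro _ ⟨η, hη, rfl⟩
  have hnn : ∀ v, 0 ≤ min (η v) 1 := fun v => le_min (hη.1 v) zero_le_one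
  have hcap : Feasible W (fun v => min (η v) 1) := by
    refine ⟨hnn, fun v => ?_⟩
    by_cases hbig : ∃ u, W v u = 1 ∧ 1 ≤ η u
    · obtain ⟨u, hu, hu1⟩ := hbig
      have := Finset.single_le_sum (f := fun u => W v u * min (η u) 1)
        (fun u _ => mul_nonneg (hW.2.1 v u).1 (hnn u)) (Finset.mem_univ u)
      simpa [hu, hu1] using this
    · push Not at hbig
      refine (hη.2 v).trans_eq (Finset.sum_congr rfl fun u _ => ?_)
      rcases weight_eq_zero_or_one hW hU v u with h | h
      · simp [h]
      · simp only [min_eq_left (hbig u h).le]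
  exact (hmin ⟨hcap, fun v => min_le_right _ _⟩).trans
    (Finset.sum_le_sum fun v _ => min_le_left _ _)

/-- The total excess coverage of a feasible solution bounds its distance to the optimum. -/
lemma card_add_sub_le_coverage {W : V → V → ℝ} (hW : IsCollab W) {θ η : V → ℝ}
    (hθ : Feasible W θ) (hη : Feasible W η) (hη1 : ∀ v, η v ≤ 1) :
    (Fintype.card V : ℝ) + (∑ v, θ v - ∑ v, η v) ≤ ∑ v, ∑ u, W v u * θ u := by
  have h1 : ∑ v, η v * (∑ u, W v u * θ u - 1) ≤ ∑ v, (∑ u, W v u * θ u - 1) :=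
    Finset.sum_le_sum fun v _ =>
      mul_le_of_le_one_left (by linarith [hθ.2 v]) (hη1 v)
  have h2 : ∑ v, η v * ∑ u, W v u * θ u = ∑ v, θ v * ∑ u, W v u * η u := by
    simp only [Finset.mul_sum]
    rw [Finset.sum_comm]
    refine Finset.sum_congr rfl fun v _ => Finset.sum_congr rfl fun u _ => ?_
    rw [hW.1 u v]; ring
  have h3 : ∑ v, θ v ≤ ∑ v, θ v * ∑ u, W v u * η u :=
    Finset.sum_le_sum fun v _ => le_mul_of_one_le_right (hθ.1 v) (hη.2 v)
  simp only [mul_sub, mul_one, Finset.sum_sub_distrib, Finset.sum_const, Finset.card_univ,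
    nsmul_eq_mul] at h1
  linarith

lemma card_le_coverage {W : V → V → ℝ} {θ : V → ℝ} (hθ : Feasible W θ) :
    (Fintype.card V : ℝ) ≤ ∑ v, ∑ u, W v u * θ u := by
  have := Finset.sum_le_sum fun v (_ : v ∈ Finset.univ) => hθ.2 v
  simpa using this

lemma edge_weight_le_sq [DecidableEq V] {W : V → V → ℝ} (hW : IsCollab W) {θ : V → ℝ} (hθ : ∀ v, 0 ≤ θ v) :
    0 ≤ (stats W θ).2.1 ∧ (stats W θ).2.1 ≤ (∑ v, θ v) ^ 2 := by
  have hnn : ∀ u v, 0 ≤ W v u * (θ v * θ u) := fun u v =>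
    mul_nonneg (hW.2.1 v u).1 (mul_nonneg (hθ v) (hθ u))
  refine ⟨Finset.sum_nonneg fun v _ => Finset.sum_nonneg fun u _ => hnn u v, ?_⟩
  rw [sq, Finset.sum_mul_sum]
  refine Finset.sum_le_sum fun v _ => ?_
  refine (Finset.sum_le_sum_of_subset_of_nonneg (Finset.erase_subset v _)
    fun u _ _ => hnn u v).trans (Finset.sum_le_sum fun u _ => ?_)
  exact mul_le_of_le_one_left (mul_nonneg (hθ v) (hθ u)) (hW.2.1 v u).2

end Optimum

section Mixing

variable [Fintype V] [DecidableEq V]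

/-- Mixing a stable solution with the rounding of an optimal one. -/
lemma exists_scheme_of_rounding {W : V → V → ℝ} (hW : IsCollab W) {S O P K Ds Do p : ℝ}
    (hstable : (S, (0 : ℝ), Ds) ∈ convexHull ℝ (stats W '' binaryVectors V))
    (hround : (O, K, Do) ∈ convexHull ℝ (stats W '' binaryVectors V))
    (hP : 1 < P) (hO : 1 ≤ O) (hSP : S = P * O) (hK0 : 0 ≤ K) (hK : K ≤ O ^ 2)
    (hDs : Fintype.card V + (S - O) ≤ Ds) (hDo : Fintype.card V ≤ Do)
    (hp0 : 0 < p) (hp : p ≤ 1 / 2)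
    (hle : p * (P ^ 2 + P + 2 * Fintype.card V) ≤ P ^ 2 - 1) :
    ∃ D : Scheme V, D.sig.card ≤ 2 ∧ D.Persuasive W ∧ D.cost ≤ S - p * (S - O) := by
  set n : ℝ := (Fintype.card V : ℝ)
  have hn : 0 ≤ n := Nat.cast_nonneg _
  have hmem := convex_convexHull ℝ _ hround hstable hp0.le (by linarith : 0 ≤ 1 - p) (by ring)
  simp only [Prod.smul_mk, Prod.mk_add_mk, smul_eq_mul, mul_zero, add_zero] at hmem
  have hC : 0 < p * O + (1 - p) * S := by
    rw [hSP]
    have : 0 ≤ (1 - p) * (P * O) := mul_nonneg (by linarith) (by positivity)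
    have : 0 < p * O := by positivity
    linarith
  have hratio : n * p ≤ (1 - p) * (P - 1) * (p + (1 - p) * P) := by
    have h1 : 0 ≤ (1 - p) * (P - 1) * ((P - 1) * (1 - 2 * p)) :=
      mul_nonneg (mul_nonneg (by linarith) (by linarith))
        (mul_nonneg (by linarith) (by linarith))
    nlinarith [mul_pos hp0 (by linarith : 0 < P + 1)]
  have hexcess : n * (p * K) ≤ (p * O + (1 - p) * S) * ((1 - p) * (S - O)) :=
    calc n * (p * K) ≤ n * (p * O ^ 2) := by gcongr
      _ = (n * p) * O ^ 2 := by ring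
      _ ≤ ((1 - p) * (P - 1) * (p + (1 - p) * P)) * O ^ 2 := by gcongr
      _ = _ := by rw [hSP]; ring
  have hD : n + (1 - p) * (S - O) ≤ p * Do + (1 - p) * Ds := by
    have h1 := mul_le_mul_of_nonneg_left hDo hp0.le
    have h2 := mul_le_mul_of_nonneg_left hDs (by linarith : 0 ≤ 1 - p)
    linarith
  set C := p * O + (1 - p) * S
  have hCK : 0 < C + p * K := by positivity
  have hx1 : C / (C + p * K) ≤ 1 := (div_le_one hCK).2 (by linarith [mul_nonneg hp0.le hK0])
  obtain ⟨D, h1, h2, h3⟩ := exists_persuasive_of_mem_convexHull hW (div_pos hC hCK) hx1 hmem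
    (by field_simp; ring)
    (by
      rw [div_mul_eq_mul_div, le_div_iff₀ hCK]
      have := mul_le_mul_of_nonneg_left hD hC.le
      linarith)
  refine ⟨D, h1, h2, ?_⟩
  rw [h3]
  calc _ ≤ C := mul_le_of_le_one_left hC.le hx1
    _ = _ := by simp only [C]; ring

/-- Mixing a stable solution with the all-zero signal. -/
lemma exists_scheme_of_scaling {W : V → V → ℝ} (hW : IsCollab W) {S O P Ds : ℝ}
    (hstable : (S, (0 : ℝ), Ds) ∈ convexHull ℝ (stats W '' binaryVectors V))
    (hP : 1 < P) (hO : 1 ≤ O) (hOn : O ≤ Fintype.card V) (hSP : S = P * O)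
    (hDs : Fintype.card V + (S - O) ≤ Ds) :
    ∃ D : Scheme V, D.sig.card ≤ 2 ∧ D.Persuasive W ∧
      D.cost ≤ S - (P - 1) / (P + (Fintype.card V - O)) * (S - O) := by
  set n : ℝ := (Fintype.card V : ℝ)
  have hSO : 0 < S - O := by rw [hSP]; nlinarith
  have hDpos : 0 < Ds := by linarith
  have hzero : ((0 : ℝ), (0 : ℝ), (0 : ℝ)) ∈ convexHull ℝ (stats W '' binaryVectors V) :=
    subset_convexHull ℝ _ ⟨0, fun _ => Or.inl rfl, by simp [stats]⟩
  have ha0 : 0 ≤ n / Ds := by positivity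
  have ha1 : n / Ds ≤ 1 := (div_le_one hDpos).2 (by linarith)
  have hmem := convex_convexHull ℝ _ hstable hzero ha0 (sub_nonneg.2 ha1) (by ring)
  simp only [Prod.smul_mk, Prod.mk_add_mk, smul_eq_mul, mul_zero, add_zero,
    div_mul_cancel₀ n hDpos.ne'] at hmem
  obtain ⟨D, h1, h2, h3⟩ := exists_persuasive_of_mem_convexHull hW one_pos le_rfl hmem
    (by ring) (by rw [one_mul])
  refine ⟨D, h1, h2, ?_⟩
  have hden : 0 < P + (n - O) := by linarith
  have hden' : 0 < n + (S - O) := by linarith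
  have hε : (P - 1) / (P + (n - O)) ≤ S / (n + (S - O)) := by
    rw [div_le_div_iff₀ hden hden']
    have hPS : P ≤ S := by rw [hSP]; nlinarith
    nlinarith [mul_nonneg (by linarith : 0 ≤ S - P + 1) (by linarith : 0 ≤ n - O)]
  rw [h3, one_mul]
  calc n / Ds * S ≤ n / (n + (S - O)) * S := by
        have : 0 ≤ S := by linarith
        gcongr
    _ = S - S / (n + (S - O)) * (S - O) := by field_simp; ring
    _ ≤ _ := by gcongr

end Mixing

/-- On a unit-weight instance admitting an optimal stable solution with
`OPT < OPT^stable`, setting `PoS = OPT^stable / OPT` and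
`ε = max { min {1/2, (PoS−1)/(PoS + 2n/(PoS+1))}, (PoS−1)/(PoS + (n − OPT)) }`,
we have `ε > 0` and there is a persuasive binary identity-independent signaling scheme `D`
with `Cost(D) ≤ OPT^stable − ε·(OPT^stable − OPT)`, hence `Cost(D) < OPT^stable`. -/
theorem statement7 (V : Type*) [Fintype V] [DecidableEq V] (W : V → V → ℝ)
    (hW : IsCollab W) (hU : UnitWeight W)
    (θs : V → ℝ) (hθs : Stable W θs)
    (hopt : ∀ θ : V → ℝ, Stable W θ → ∑ v, θs v ≤ ∑ v, θ v)
    (hgap : OPT W < ∑ v, θs v) :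
    let n : ℝ := (Fintype.card V : ℝ)
    let OPTstable : ℝ := ∑ v, θs v
    let PoS : ℝ := OPTstable / OPT W
    let ε : ℝ := max (min (1 / 2) ((PoS - 1) / (PoS + 2 * n / (PoS + 1))))
                     ((PoS - 1) / (PoS + (n - OPT W)))
    0 < ε ∧ ∃ D : Scheme V, D.sig.card ≤ 2 ∧ D.Persuasive W ∧
      D.cost ≤ OPTstable - ε * (OPTstable - OPT W) := by
  intro n S P ε
  obtain ⟨θo, hθo, hθo1, hsum⟩ := exists_optimal hW hU
  set O := OPT W
  have hne : Nonempty V := by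
    by_contra h
    rw [not_nonempty_iff] at h
    simp [← hsum] at hgap
  have hO1 : 1 ≤ O := by
    obtain ⟨v⟩ := hne
    rw [← hsum]
    exact (hθo.2 v).trans (Finset.sum_le_sum fun u _ =>
      mul_le_of_le_one_left (hθo.1 u) (hW.2.1 v u).2)
  have hOn : O ≤ n := by
    rw [← hsum]
    simpa [n] using Finset.sum_le_sum fun v (_ : v ∈ Finset.univ) => hθo1 v
  have hSP : S = P * O := (div_mul_cancel₀ S (by linarith)).symm
  have hgap' : O < S := hgap
  have hP : 1 < P := by simp only [P]; rw [one_lt_div (by linarith)]; exact hgap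
  have hstable := stats_mem_convexHull_of_indep (hθs.mem_convexHull_indepVectors hW hU)
  have hround := stats_mem_convexHull W θo fun v => ⟨hθo.1 v, hθo1 v⟩
  obtain ⟨hK0, hK⟩ := edge_weight_le_sq hW hθo.1
  have hDs := card_add_sub_le_coverage hW hθs.1 hθo hθo1
  have hDo := card_le_coverage hθo
  simp only [stats, hsum] at hround hK0 hK
  rw [hsum] at hDs
  change (S, (0 : ℝ), _) ∈ _ at hstable
  change n + (S - O) ≤ _ at hDs
  change n ≤ _ at hDo
  set Ds := ∑ v, ∑ u, W v u * θs u
  set Do := ∑ v, ∑ u, W v u * θo u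
  set K := ∑ v, ∑ u ∈ Finset.univ.erase v, W v u * (θo v * θo u)
  have hden : 0 < P + 2 * n / (P + 1) := by positivity
  have hden2 : 0 < P + (n - O) := by linarith
  have hε2 : 0 < (P - 1) / (P + (n - O)) := div_pos (by linarith) hden2
  refine ⟨lt_max_of_lt_right hε2, ?_⟩
  rcases max_choice (min (1 / 2) ((P - 1) / (P + 2 * n / (P + 1)))) ((P - 1) / (P + (n - O)))
    with h | h
  · have hεp : 0 < ε := lt_max_of_lt_right hε2
    change ε = _ at h
    have hhalf : ε ≤ 1 / 2 := h.trans_le (min_le_left _ _)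
    have hle : ε * (P ^ 2 + P + 2 * n) ≤ P ^ 2 - 1 := by
      have := h.trans_le (min_le_right _ _)
      rw [le_div_iff₀ hden] at this
      have h2 := mul_le_mul_of_nonneg_right this (by linarith : 0 ≤ P + 1)
      have h3 : ε * (P + 2 * n / (P + 1)) * (P + 1) = ε * (P ^ 2 + P + 2 * n) := by
        field_simp
      linarith
    exact exists_scheme_of_rounding hW hstable hround hP hO1 hSP hK0 hK hDs hDo hεp hhalf hle
  · change ε = _ at h
    rw [h]
    exact exists_scheme_of_scaling hW hstable hP hO1 hOn hSP hDs
end
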